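/- Let d, n ≥ 1 and let 𝐪 = (Q_1, …, Q_n) be an n-tuple of quadratic forms in d variables. Then for every 0 ≤ n' ≤ n and all exponents 2 ≤ q ≤ ∞ and 2 ≤ p ≤ ∞ (with the convention 1/∞ = 0), Γ_{q,p}(𝐪) ≥ d(1 − 1/p − 1/q) − 𝔡_{n'}(𝐪)(1/2 − 1/p) − 2(n − n')/p. -/

import Mathlib

open MeasureTheory
open scoped ENNReal

noncomputable section

namespace GOZZK

/-- A quadratic form in `d` real variables. -/
abbrev QF (d : ℕ) := QuadraticForm ℝ (Fin d → ℝ)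

/-- `NV 𝐩`: the number of variables that some component of the tuple `𝐩` of quadratic
forms depends on (equivalently, the number of indices `j` such that `∂_{ξ_j} P ≢ 0` for some
component `P` of `𝐩`). -/
def NV {d : ℕ} {ι : Type*} (Q : ι → QF d) : ℕ :=
  Set.ncard { j : Fin d | ∃ i, ∃ ξ : Fin d → ℝ, Q i (Function.update ξ j 0) ≠ Q i ξ }

/-- `𝔡_{d',n'}(𝐪)`: the infimum of `NV (M' · (𝐪 ∘ M))` over all real `d × d` matrices `M`
of rank `d'` and all real `n × n` matrices `M'` of rank `n'`. -/
def numvar {d : ℕ} {ι : Type*} [Fintype ι] [DecidableEq ι]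
    (Q : ι → QF d) (d' n' : ℕ) : ℕ :=
  sInf { k | ∃ (M : Matrix (Fin d) (Fin d) ℝ) (M' : Matrix ι ι ℝ),
    M.rank = d' ∧ M'.rank = n' ∧
    NV (fun i => ∑ i' : ι, M' i i' • (Q i').comp (Matrix.vecMulLinear M)) = k }

/-- The center of the dyadic subcube of `[0,1]^d` of side length `2⁻ᵏ` indexed by `ν`. -/
def center {d : ℕ} (k : ℕ) (ν : Fin d → Fin (2 ^ k)) : Fin d → ℝ :=
  fun j => (ν j : ℕ) / 2 ^ k + 1 / 2 ^ (k + 1)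

/-- The uncertainty parallelepiped `𝒰_□ = (a, 𝐪(a)) + L_□ᵀ([-C,C]^{d+n})` attached to the
cube of side `δ` centered at `a`; here `∇𝐪(a)ᵀ x = (polar Qᵢ (a, x))ᵢ`. -/
def Ubox {d n : ℕ} (Q : Fin n → QF d) (δ C : ℝ) (a : Fin d → ℝ) :
    Set ((Fin d → ℝ) × (Fin n → ℝ)) :=
  { z | ∃ (u : Fin d → ℝ) (v : Fin n → ℝ), (∀ j, |u j| ≤ C) ∧ (∀ i, |v i| ≤ C) ∧
      z.1 = (fun j => a j + δ * u j) ∧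
      z.2 = (fun i => Q i a + QuadraticMap.polar (⇑(Q i)) a (δ • u) + δ ^ 2 * v i) }

/-- The Fourier transform of a function on `ℝ^d × ℝⁿ`. -/
def fourierT {d n : ℕ} (f : ((Fin d → ℝ) × (Fin n → ℝ)) → ℂ)
    (ξ : (Fin d → ℝ) × (Fin n → ℝ)) : ℂ :=
  ∫ z : (Fin d → ℝ) × (Fin n → ℝ),
    Complex.exp (((-(2 * Real.pi * ((∑ j, z.1 j * ξ.1 j) + ∑ i, z.2 i * ξ.2 i)) : ℝ) : ℂ)
      * Complex.I) * f z

/-- The `ℓ^q` norm of a finite tuple of extended nonnegative reals (interpreted as a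
supremum when `q = ∞`). -/
def lqNorm {ι : Type*} [Fintype ι] (q : ℝ≥0∞) (a : ι → ℝ≥0∞) : ℝ≥0∞ :=
  if q = ∞ then ⨆ i, a i else (∑ i : ι, a i ^ q.toReal) ^ (1 / q.toReal)

/-- The `ℓ^q L^p` decoupling constant `Dec_{q,p}(𝐪, δ)` at scale `δ = 2⁻ᵏ`, with
uncertainty boxes of size parameter `C`: the smallest constant `D` such that
`‖∑_□ f_□‖_{L^p(ℝ^{d+n})} ≤ D (∑_□ ‖f_□‖_{L^p(ℝ^{d+n})}^q)^{1/q}` holds for every tuple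
of Schwartz functions `f_□` whose Fourier transform is supported in `𝒰_□`. -/
def DecConst {d n : ℕ} (Q : Fin n → QF d) (C : ℝ) (q p : ℝ≥0∞) (k : ℕ) : ℝ :=
  sInf { D : ℝ | 0 ≤ D ∧
    ∀ f : (Fin d → Fin (2 ^ k)) → SchwartzMap ((Fin d → ℝ) × (Fin n → ℝ)) ℂ,
      (∀ ν, Function.support (fourierT (⇑(f ν))) ⊆ Ubox Q (1 / 2 ^ k) C (center k ν)) →
      eLpNorm (fun z => ∑ ν, f ν z) p volume ≤
        ENNReal.ofReal D * lqNorm q (fun ν => eLpNorm (⇑(f ν)) p volume) }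

/-- The decoupling exponent `Γ_{q,p}(𝐪)`: the smallest `Γ` such that for every `ε > 0`
there is `C_ε` with `Dec_{q,p}(𝐪, δ) ≤ C_ε δ^{-Γ-ε}` for all dyadic `δ = 2⁻ᵏ < 1`. -/
def Gamma {d n : ℕ} (Q : Fin n → QF d) (C : ℝ) (q p : ℝ≥0∞) : ℝ :=
  sInf { G : ℝ | ∀ ε : ℝ, 0 < ε → ∃ Cε : ℝ, ∀ k : ℕ, 1 ≤ k →
    DecConst Q C q p k ≤ Cε * (1 / 2 ^ k : ℝ) ^ (-(G + ε)) }

instance haarX (d n : ℕ) :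
    (volume : Measure ((Fin d → ℝ) × (Fin n → ℝ))).IsAddHaarMeasure := by
  rw [Measure.volume_eq_prod]
  exact Measure.prod.instIsAddHaarMeasure _ _

/-- The standard pairing on `ℝ^d × ℝ^n`. -/
def dot {d n : ℕ} (z w : (Fin d → ℝ) × (Fin n → ℝ)) : ℝ :=
  (∑ j, z.1 j * w.1 j) + ∑ i, z.2 i * w.2 i

/-- The pairing as a continuous linear functional in the first slot. -/
def dotL {d n : ℕ} (w : (Fin d → ℝ) × (Fin n → ℝ)) : ((Fin d → ℝ) × (Fin n → ℝ)) →ₗ[ℝ] ℝ where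
  toFun z := dot z w
  map_add' z z' := by
    simp only [dot, Prod.fst_add, Prod.snd_add, Pi.add_apply, add_mul, Finset.sum_add_distrib]
    ring
  map_smul' c z := by
    simp only [dot, Prod.smul_fst, Prod.smul_snd, Pi.smul_apply, smul_eq_mul, mul_assoc,
      ← Finset.mul_sum, RingHom.id_apply]
    ring

lemma dot_sub_right {d n : ℕ} (z w w' : (Fin d → ℝ) × (Fin n → ℝ)) :
    dot z (w - w') = dot z w - dot z w' := by
  simp only [dot, Prod.fst_sub, Prod.snd_sub, Pi.sub_apply, mul_sub, Finset.sum_sub_distrib]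
  ring

lemma exists_dot_repr {d n : ℕ} (l : ((Fin d → ℝ) × (Fin n → ℝ)) →ₗ[ℝ] ℝ) :
    ∃ κ, ∀ z, l z = dot z κ := by
  refine ⟨(fun j => l (Pi.single j 1, 0), fun i => l (0, Pi.single i 1)), fun z => ?_⟩
  have h1 : z = ∑ j, z.1 j • ((Pi.single j 1, 0) : (Fin d → ℝ) × (Fin n → ℝ))
      + ∑ i, z.2 i • ((0, Pi.single i 1) : (Fin d → ℝ) × (Fin n → ℝ)) := by
    ext j
    · simp [Prod.fst_sum, Finset.sum_apply, Pi.single_apply]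
    · simp [Prod.snd_sum, Finset.sum_apply, Pi.single_apply]
  conv_lhs => rw [h1]
  rw [map_add, map_sum, map_sum]
  simp only [map_smul, smul_eq_mul, dot]

lemma temperate_cexp : (fun t : ℝ => Complex.exp ((t : ℂ) * Complex.I)).HasTemperateGrowth := by
  have hc : ContDiff ℝ (⊤ : ℕ∞) (fun t : ℝ => Complex.exp ((t : ℂ) * Complex.I)) :=
    (Complex.ofRealCLM.contDiff.mul contDiff_const).cexp
  refine ⟨hc, fun n => ⟨0, 1, fun x => ?_⟩⟩
  have key : ∀ n : ℕ, iteratedDeriv n (fun t : ℝ => Complex.exp ((t : ℂ) * Complex.I))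
      = fun t : ℝ => Complex.I ^ n * Complex.exp ((t : ℂ) * Complex.I) := by
    intro n
    induction n with
    | zero => simp
    | succ n ih =>
      rw [iteratedDeriv_succ, ih]
      ext t
      have h0 : HasDerivAt (fun t : ℝ => ((t : ℂ) * Complex.I)) Complex.I t := by
        simpa using (Complex.ofRealCLM.hasDerivAt (x := t)).mul_const Complex.I
      have h1 := (h0.cexp).const_mul (Complex.I ^ n)
      rw [h1.deriv]
      ring
  rw [norm_iteratedFDeriv_eq_norm_iteratedDeriv, key]
  simp [Complex.norm_exp]

open SchwartzMap FourierTransform in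
/-- A Schwartz function equal to `1` at the origin, with Fourier support in a small box. -/
lemma exists_phi (d n : ℕ) (ρ : ℝ) (hρ : 0 < ρ) :
    ∃ φ : SchwartzMap ((Fin d → ℝ) × (Fin n → ℝ)) ℂ, φ 0 = 1 ∧
      ∀ ξ, fourierT (⇑φ) ξ ≠ 0 → (∀ j, |ξ.1 j| ≤ ρ) ∧ (∀ i, |ξ.2 i| ≤ ρ) := by
  classical
  let E := EuclideanSpace ℝ (Fin d ⊕ Fin n)
  let e0 : ((Fin d → ℝ) × (Fin n → ℝ)) ≃ₗ[ℝ] E :=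
    (LinearEquiv.sumArrowLequivProdArrow (Fin d) (Fin n) ℝ ℝ).symm ≪≫ₗ
      (WithLp.linearEquiv 2 ℝ (Fin d ⊕ Fin n → ℝ)).symm
  let e : ((Fin d → ℝ) × (Fin n → ℝ)) ≃L[ℝ] E := e0.toContinuousLinearEquiv
  have he1 : ∀ z j, e z (Sum.inl j) = z.1 j := fun z j => rfl
  have he2 : ∀ z i, e z (Sum.inr i) = z.2 i := fun z i => rfl
  let b : ContDiffBump (0 : E) := ⟨ρ / 2, ρ, by positivity, by linarith⟩
  have hcs : HasCompactSupport (fun x : E => ((b.normed volume x : ℝ) : ℂ)) :=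
    b.hasCompactSupport_normed.comp_left (g := fun t : ℝ => (t : ℂ)) (by simp)
  have hsm : ContDiff ℝ (⊤ : ℕ∞) (fun x : E => ((b.normed volume x : ℝ) : ℂ)) :=
    Complex.ofRealCLM.contDiff.comp b.contDiff_normed
  let g : SchwartzMap E ℂ := hcs.toSchwartzMap hsm
  have hg : ∀ x, g x = ((b.normed volume x : ℝ) : ℂ) := fun x => rfl
  let ψ : SchwartzMap E ℂ := 𝓕⁻ g
  have hψ0 : ψ 0 = 1 := by
    have : ψ 0 = 𝓕⁻ (g : E → ℂ) 0 := by
      rw [← SchwartzMap.fourierInv_coe]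
    rw [this, Real.fourierInv_eq]
    simp only [inner_zero_right, AddChar.map_zero_eq_one, one_smul, hg]
    rw [integral_complex_ofReal, b.integral_normed]
    simp
  refine ⟨compCLMOfContinuousLinearEquiv ℂ e ψ, by simp [hψ0], fun ξ hξ => ?_⟩
  have hmap : Measure.IsAddHaarMeasure (Measure.map e (volume : Measure ((Fin d → ℝ) × (Fin n → ℝ)))) :=
    e.isAddHaarMeasure_map _
  have hF : fourierT (⇑(compCLMOfContinuousLinearEquiv ℂ e ψ)) ξ
      = ((Measure.addHaarScalarFactor (Measure.map e (volume : Measure ((Fin d → ℝ) × (Fin n → ℝ)))) volume : NNReal) : ℝ) • g (e ξ) := by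
    have h1 : fourierT (⇑(compCLMOfContinuousLinearEquiv ℂ e ψ)) ξ
       = ∫ w : E, Real.fourierChar (-(inner ℝ w (e ξ))) • ψ w ∂(Measure.map e volume) := by
      rw [show Measure.map (⇑e) (volume : Measure ((Fin d → ℝ) × (Fin n → ℝ)))
        = Measure.map (⇑e.toHomeomorph) volume from rfl,
        e.toHomeomorph.measurableEmbedding.integral_map]
      unfold fourierT
      congr 1
      ext z
      rw [Circle.smul_def, Real.fourierChar_apply, smul_eq_mul]
      have : inner ℝ (e z) (e ξ) = (∑ j, z.1 j * ξ.1 j) + ∑ i, z.2 i * ξ.2 i := by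
        rw [PiLp.inner_apply, Fintype.sum_sum_type]
        simp [he1, he2, mul_comm]
      simp only [ContinuousLinearEquiv.coe_toHomeomorph, this]
      have h5 : (compCLMOfContinuousLinearEquiv ℂ e ψ) z = ψ (e z) := rfl
      rw [h5]
      congr 3
      push_cast
      ring
    have h4 := congrArg (fun ν => ∫ w : E, Real.fourierChar (-(inner ℝ w (e ξ))) • ψ w ∂ν)
      (Measure.isAddLeftInvariant_eq_smul (Measure.map e volume) (volume : Measure E))
    rw [h1]
    refine h4.trans ?_
    rw [integral_smul_nnreal_measure]
    have h2 : ∫ w : E, Real.fourierChar (-(inner ℝ w (e ξ))) • ψ w = g (e ξ) := by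
      rw [← Real.fourier_eq, ← SchwartzMap.fourier_coe]
      simp only [ψ, FourierTransform.fourier_fourierInv_eq]
    rw [h2]; rfl
  have hgne : g (e ξ) ≠ 0 := by
    intro h; apply hξ; rw [hF, h, smul_zero]
  have hmem : e ξ ∈ Metric.ball (0 : E) ρ := by
    have : e ξ ∈ Function.support (b.normed volume) := by
      rw [Function.mem_support]
      intro h; apply hgne; rw [hg, h]; simp
    rwa [b.support_normed_eq] at this
  have hn : ‖e ξ‖ ≤ ρ := by
    rw [mem_ball_zero_iff] at hmem; exact hmem.le
  refine ⟨fun j => ?_, fun i => ?_⟩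
  · rw [← he1, ← Real.norm_eq_abs]; exact (PiLp.norm_apply_le _ _).trans hn
  · rw [← he2, ← Real.norm_eq_abs]; exact (PiLp.norm_apply_le _ _).trans hn

open SchwartzMap in
/-- Modulated and linearly rescaled copies of a Schwartz function. -/
lemma exists_packet {d n : ℕ} (φ : SchwartzMap ((Fin d → ℝ) × (Fin n → ℝ)) ℂ)
    (A : ((Fin d → ℝ) × (Fin n → ℝ)) ≃L[ℝ] ((Fin d → ℝ) × (Fin n → ℝ)))
    (θ : (Fin d → ℝ) × (Fin n → ℝ)) (s : ℂ) :
    ∃ f : SchwartzMap ((Fin d → ℝ) × (Fin n → ℝ)) ℂ,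
      (∀ z, f z = s * (Complex.exp (((2 * Real.pi * dot z θ : ℝ) : ℂ) * Complex.I) * φ (A z))) ∧
      ∀ ζ, fourierT (⇑f) ζ ≠ 0 →
        ∃ κ, fourierT (⇑φ) κ ≠ 0 ∧ ∀ z, dot z (ζ - θ) = dot (A z) κ := by
  let l : ((Fin d → ℝ) × (Fin n → ℝ)) →L[ℝ] ℝ := ((2 * Real.pi) • dotL θ).toContinuousLinearMap
  have hl : ∀ z, l z = 2 * Real.pi * dot z θ := fun z => rfl
  have ht := temperate_cexp.comp l.hasTemperateGrowth
  let f0 := smulLeftCLM ℂ ((fun t : ℝ => Complex.exp ((t : ℂ) * Complex.I)) ∘ l)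
    (compCLMOfContinuousLinearEquiv ℂ A φ)
  have hf0 : ∀ z, f0 z = Complex.exp (((2 * Real.pi * dot z θ : ℝ) : ℂ) * Complex.I) * φ (A z) := by
    intro z
    simp only [f0]
    rw [smulLeftCLM_apply_apply ht]
    simp [hl]
  refine ⟨s • f0, fun z => by rw [smul_apply, hf0, smul_eq_mul], fun ζ hζ => ?_⟩
  obtain ⟨κ, hκ⟩ := exists_dot_repr ((dotL (ζ - θ)).comp (A.symm : _ ≃L[ℝ] _).toLinearEquiv.toLinearMap)
  have hκ' : ∀ z, dot z (ζ - θ) = dot (A z) κ := by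
    intro z
    rw [← hκ (A z)]
    simp [dotL]
  refine ⟨κ, ?_, hκ'⟩
  intro h0
  apply hζ
  have hmap : Measure.IsAddHaarMeasure (Measure.map A (volume : Measure ((Fin d → ℝ) × (Fin n → ℝ)))) :=
    A.isAddHaarMeasure_map _
  have h1 : fourierT (⇑(s • f0)) ζ = ∫ z, (fun w => s * (Complex.exp (((-(2 * Real.pi * dot w κ) : ℝ) : ℂ)
      * Complex.I) * φ w)) (A z) := by
    unfold fourierT
    congr 1
    ext z
    simp only [smul_apply, smul_eq_mul, hf0]
    rw [← hκ' z, dot_sub_right]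
    have : Complex.exp (((-(2 * Real.pi * (dot z ζ - dot z θ)) : ℝ) : ℂ) * Complex.I)
      = Complex.exp (((-(2 * Real.pi * ((∑ j, z.1 j * ζ.1 j) + ∑ i, z.2 i * ζ.2 i)) : ℝ) : ℂ)
      * Complex.I) * Complex.exp (((2 * Real.pi * dot z θ : ℝ) : ℂ) * Complex.I) := by
      rw [← Complex.exp_add]
      congr 1
      simp only [dot]
      push_cast
      ring
    rw [this]
    ring
  rw [h1]
  refine (A.toHomeomorph.measurableEmbedding.integral_map (μ := volume)
    (fun w => s * (Complex.exp (((-(2 * Real.pi * dot w κ) : ℝ) : ℂ)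
      * Complex.I) * φ w))).symm.trans ?_
  have h2 : Measure.map (⇑A.toHomeomorph) (volume : Measure ((Fin d → ℝ) × (Fin n → ℝ))) = Measure.map A volume := rfl
  rw [h2, Measure.isAddLeftInvariant_eq_smul (Measure.map A volume) (volume : Measure ((Fin d → ℝ) × (Fin n → ℝ)))]
  rw [integral_smul_nnreal_measure, integral_const_mul]
  have h3 : ∫ w, Complex.exp (((-(2 * Real.pi * dot w κ) : ℝ) : ℂ) * Complex.I) * φ w = fourierT (⇑φ) κ := rfl
  rw [h3, h0]
  simp

lemma parallelogram_enorm (a b : ℂ) :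
    ‖a + b‖ₑ ^ 2 + ‖a - b‖ₑ ^ 2 = 2 * ‖a‖ₑ ^ 2 + 2 * ‖b‖ₑ ^ 2 := by
  have h := parallelogram_law_with_norm ℝ a b
  have h2 : ∀ c : ℂ, ‖c‖ₑ ^ 2 = ENNReal.ofReal (‖c‖ ^ 2) := by
    intro c
    rw [← ofReal_norm, ENNReal.ofReal_pow (norm_nonneg c)]
  have h3 : (2 : ℝ≥0∞) = ENNReal.ofReal 2 := by simp
  rw [h2, h2, h2, h2, h3, ← ENNReal.ofReal_mul (by norm_num), ← ENNReal.ofReal_mul (by norm_num),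
    ← ENNReal.ofReal_add (by positivity) (by positivity),
    ← ENNReal.ofReal_add (by positivity) (by positivity)]
  congr 1
  nlinarith [h]

/-- Choice of signs making an `L²` norm at least the square function. -/
lemma exists_signs {α ι : Type*} [MeasurableSpace α] [DecidableEq ι] (μ : Measure α)
    (F : ι → α → ℂ) (hF : ∀ i, Measurable (F i)) (t : Finset ι) :
    ∃ s : ι → ℂ, (∀ i, ‖s i‖ = 1) ∧
      ∑ i ∈ t, ∫⁻ z, ‖F i z‖ₑ ^ 2 ∂μ ≤ ∫⁻ z, ‖∑ i ∈ t, s i * F i z‖ₑ ^ 2 ∂μ := by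
  induction t using Finset.induction_on with
  | empty => exact ⟨fun _ => 1, by simp, by simp⟩
  | insert a t ha ih =>
    obtain ⟨s, hs, hle⟩ := ih
    set G : α → ℂ := fun z => ∑ i ∈ t, s i * F i z with hG
    have hGm : Measurable G := Finset.measurable_sum _ fun i _ => (hF i).const_mul _
    have hpar : ∫⁻ z, ‖G z + F a z‖ₑ ^ 2 ∂μ + ∫⁻ z, ‖G z - F a z‖ₑ ^ 2 ∂μ
        = 2 * ∫⁻ z, ‖G z‖ₑ ^ 2 ∂μ + 2 * ∫⁻ z, ‖F a z‖ₑ ^ 2 ∂μ := by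
      rw [← lintegral_add_left (f := fun z => ‖G z + F a z‖ₑ ^ 2) ((hGm.add (hF a)).enorm.pow_const 2),
        ← lintegral_const_mul _ (hGm.enorm.pow_const 2),
        ← lintegral_const_mul _ ((hF a).enorm.pow_const 2),
        ← lintegral_add_left ((hGm.enorm.pow_const 2).const_mul 2)]
      congr 1
      ext z
      exact parallelogram_enorm _ _
    have hsum : ∀ c : ℂ, ∀ z, ∑ i ∈ insert a t, (Function.update s a c) i * F i z
        = c * F a z + G z := by
      intro c z
      rw [Finset.sum_insert ha, Function.update_self]
      congr 1
      apply Finset.sum_congr rfl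
      intro i hi
      rw [Function.update_of_ne]
      rintro rfl
      exact ha hi
    have hnorm : ∀ c : ℂ, ‖c‖ = 1 → ∀ i, ‖Function.update s a c i‖ = 1 := by
      intro c hc i
      by_cases h : i = a
      · subst h; simpa using hc
      · rw [Function.update_of_ne h]; exact hs i
    rw [Finset.sum_insert ha]
    by_cases hc : ∫⁻ z, ‖F a z‖ₑ ^ 2 ∂μ + ∫⁻ z, ‖G z‖ₑ ^ 2 ∂μ ≤ ∫⁻ z, ‖G z + F a z‖ₑ ^ 2 ∂μ
    · refine ⟨Function.update s a 1, hnorm 1 (by simp), ?_⟩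
      simp only [hsum, one_mul]
      refine (add_le_add le_rfl hle).trans (hc.trans (le_of_eq ?_))
      simp only [add_comm]
    · refine ⟨Function.update s a (-1), hnorm (-1) (by simp), ?_⟩
      simp only [hsum]
      refine (add_le_add le_rfl hle).trans ?_
      have : ∫⁻ z, ‖F a z‖ₑ ^ 2 ∂μ + ∫⁻ z, ‖G z‖ₑ ^ 2 ∂μ ≤ ∫⁻ z, ‖G z - F a z‖ₑ ^ 2 ∂μ := by
        by_contra hc2
        push Not at hc hc2
        have := ENNReal.add_lt_add hc hc2
        rw [hpar] at this
        apply absurd this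
        rw [not_lt]
        apply le_of_eq
        ring
      refine this.trans (le_of_eq ?_)
      congr 1
      ext z
      congr 2
      ring

/-- Normal form coming from a minimiser in the definition of `numvar`. -/
lemma numvar_normal {d n : ℕ} (Q : Fin n → QF d) (n' : ℕ) (hn' : n' ≤ n) :
    ∃ (M : Matrix (Fin d) (Fin d) ℝ) (N : (Fin n → ℝ) ≃ₗ[ℝ] (Fin n → ℝ))
      (S : Finset (Fin d)) (S' : Finset (Fin n)),
      IsUnit M.det ∧ S.card = numvar Q d n' ∧ S'.card = n' ∧
      ∀ τ : Fin n → ℝ, (∀ i, i ∉ S' → τ i = 0) → ∀ ξ ξ' : Fin d → ℝ, (∀ j ∈ S, ξ j = ξ' j) →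
        ∑ i, N τ i * Q i (Matrix.vecMul ξ M) = ∑ i, N τ i * Q i (Matrix.vecMul ξ' M) := by
  classical
  have hne : { k | ∃ (M : Matrix (Fin d) (Fin d) ℝ) (M' : Matrix (Fin n) (Fin n) ℝ),
    M.rank = d ∧ M'.rank = n' ∧
    NV (fun i => ∑ i' : Fin n, M' i i' • (Q i').comp (Matrix.vecMulLinear M)) = k }.Nonempty := by
    refine ⟨_, 1, Matrix.diagonal (fun i : Fin n => if (i : ℕ) < n' then (1 : ℝ) else 0), ?_, ?_, rfl⟩
    · simp
    · rw [Matrix.rank_diagonal]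
      have : Fintype.card {i : Fin n // (if (i : ℕ) < n' then (1 : ℝ) else 0) ≠ 0}
        = Fintype.card {i : Fin n // (i : ℕ) < n'} := by
        apply Fintype.card_congr
        exact Equiv.subtypeEquivRight (fun i => by simp)
      rw [this, Fintype.card_subtype]
      have h2 : (Finset.univ.filter fun i : Fin n => (i : ℕ) < n').card
        = ((Finset.range n').card) := by
        apply Finset.card_bij (fun (i : Fin n) _ => (i : ℕ))
        · intro i hi; simpa using hi
        · intro i _ j _ h; exact Fin.ext h
        · intro b hb
          have hb' := Finset.mem_range.mp hb
          exact ⟨⟨b, by omega⟩, by simpa using hb', rfl⟩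
      rw [h2, Finset.card_range]
  obtain ⟨M, M', hM, hM', hNV⟩ := Nat.sInf_mem hne
  obtain ⟨k, rfl⟩ := Nat.exists_eq_add_of_le hn'
  let Λ : Submodule ℝ (Fin (n' + k) → ℝ) := LinearMap.range M'.transpose.mulVecLin
  have hΛ : Module.finrank ℝ Λ = n' := by
    have : M'.transpose.rank = n' := by rw [Matrix.rank_transpose, hM']
    exact this
  obtain ⟨Λ', hc⟩ := Submodule.exists_isCompl Λ
  have hΛ' : Module.finrank ℝ Λ' = k := by
    have := Submodule.finrank_add_eq_of_isCompl hc
    rw [hΛ] at this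
    simp at this
    exact this
  let b1 : Module.Basis (Fin n') ℝ Λ := Module.finBasisOfFinrankEq ℝ Λ hΛ
  let b2 : Module.Basis (Fin k) ℝ Λ' := Module.finBasisOfFinrankEq ℝ Λ' hΛ'
  let B := ((b1.prod b2).map (Submodule.prodEquivOfIsCompl Λ Λ' hc)).reindex finSumFinEquiv
  let P : Fin (n' + k) → QF d :=
    fun i => ∑ i', M' i i' • (Q i').comp (Matrix.vecMulLinear M)
  let T : Set (Fin d) := { j : Fin d | ∃ i, ∃ ξ : Fin d → ℝ, P i (Function.update ξ j 0) ≠ P i ξ }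
  have hT : T.toFinset.card = numvar Q d n' := by
    rw [← Set.ncard_eq_toFinset_card']
    exact hNV
  refine ⟨M, B.equivFun.symm, T.toFinset, Finset.univ.map (Fin.castAddEmb k), ?_, hT, by simp, ?_⟩
  · rw [← Matrix.isUnit_iff_isUnit_det]
    rw [← Matrix.mulVec_surjective_iff_isUnit]
    have h1 : LinearMap.range M.mulVecLin = ⊤ := by
      apply Submodule.eq_top_of_finrank_eq
      rw [Module.finrank_fin_fun]
      exact hM
    exact LinearMap.range_eq_top.mp h1
  · have hP : ∀ l ξ, P l ξ = ∑ i, M' l i * Q i (Matrix.vecMul ξ M) := by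
      intro l ξ
      simp [P]
    have hz : ∀ (U : Finset (Fin d)), (∀ j ∈ U, j ∉ T) → ∀ l ξ,
        P l ξ = P l (fun j => if j ∈ U then 0 else ξ j) := by
      intro U
      induction U using Finset.induction_on with
      | empty => intro _ l ξ; simp
      | insert a U ha ih =>
        intro hU l ξ
        rw [ih (fun j hj => hU j (Finset.mem_insert_of_mem hj)) l ξ]
        have h1 : a ∉ T := hU a (Finset.mem_insert_self _ _)
        simp only [T, Set.mem_ofPred_eq, not_exists, not_not] at h1
        rw [← h1 l (fun j => if j ∈ U then 0 else ξ j)]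
        congr 1
        ext j
        by_cases hj : j = a
        · subst hj; simp
        · rw [Function.update_of_ne hj]; simp [hj]
    have hP2 : ∀ l ξ ξ', (∀ j ∈ T.toFinset, ξ j = ξ' j) → P l ξ = P l ξ' := by
      intro l ξ ξ' h
      rw [hz (T.toFinsetᶜ) (by intro j hj; simpa using hj) l ξ,
        hz (T.toFinsetᶜ) (by intro j hj; simpa using hj) l ξ']
      congr 1
      ext j
      by_cases hj : j ∈ T.toFinset
      · simp [hj, h j hj]
      · have hj2 : j ∈ T.toFinsetᶜ := by simpa using hj
        rw [if_pos hj2, if_pos hj2]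
    intro τ hτ ξ ξ' h
    have hmem : B.equivFun.symm τ ∈ Λ := by
      rw [Module.Basis.equivFun_symm_apply]
      apply Submodule.sum_mem
      intro i _
      by_cases hi : i ∈ Finset.univ.map (Fin.castAddEmb (n := n') k)
      · apply Submodule.smul_mem
        obtain ⟨i0, _, rfl⟩ := Finset.mem_map.mp hi
        have : B (Fin.castAddEmb k i0) = b1 i0 := by
          simp only [B, Module.Basis.reindex_apply]
          rw [show (Fin.castAddEmb k i0) = finSumFinEquiv (Sum.inl i0) by simp]
          rw [Equiv.symm_apply_apply]
          simp
        rw [this]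
        exact (b1 i0).2
      · rw [hτ i hi, zero_smul]; exact Submodule.zero_mem _
    obtain ⟨lam, hlam⟩ := hmem
    have hcomb : ∀ ξ : Fin d → ℝ, ∑ i, B.equivFun.symm τ i * Q i (Matrix.vecMul ξ M)
        = ∑ l, lam l * P l ξ := by
      intro ξ
      rw [← hlam]
      simp only [Matrix.mulVecLin_apply, Matrix.mulVec, dotProduct, Matrix.transpose_apply, hP,
        Finset.sum_mul, Finset.mul_sum]
      rw [Finset.sum_comm]
      apply Finset.sum_congr rfl; intro l _
      apply Finset.sum_congr rfl; intro i _
      ring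
    rw [hcomb, hcomb]
    exact Finset.sum_congr rfl fun l _ => by rw [hP2 l ξ ξ' h]

lemma le_lqNorm {ι : Type*} [Fintype ι] (q : ℝ≥0∞) (hq : 2 ≤ q) (a : ι → ℝ≥0∞) (i : ι) :
    a i ≤ lqNorm q a := by
  unfold lqNorm
  split_ifs with h
  · exact le_iSup a i
  · have hq0 : 0 < q.toReal := ENNReal.toReal_pos (by rintro rfl; simp at hq) h
    calc a i = (a i ^ q.toReal) ^ (1 / q.toReal) := by
          rw [← ENNReal.rpow_mul, mul_one_div_cancel hq0.ne', ENNReal.rpow_one]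
      _ ≤ _ := by
          apply ENNReal.rpow_le_rpow _ (by positivity)
          exact Finset.single_le_sum (f := fun i => a i ^ q.toReal) (fun _ _ => by positivity) (Finset.mem_univ i)

lemma lqNorm_le {ι : Type*} [Fintype ι] [Nonempty ι] (q : ℝ≥0∞) (hq : 2 ≤ q) (a : ι → ℝ≥0∞)
    (b : ℝ≥0∞) (h : ∀ i, a i ≤ b) :
    lqNorm q a ≤ (Fintype.card ι : ℝ≥0∞) ^ (1 / q.toReal) * b := by
  unfold lqNorm
  split_ifs with hq'
  · subst hq'
    simpa using h
  · have hq0 : 0 < q.toReal := ENNReal.toReal_pos (by rintro rfl; simp at hq) hq'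
    calc _ ≤ (∑ _i : ι, b ^ q.toReal) ^ (1 / q.toReal) := by
          apply ENNReal.rpow_le_rpow _ (by positivity)
          exact Finset.sum_le_sum fun i _ => ENNReal.rpow_le_rpow (h i) hq0.le
      _ = _ := by
          rw [Finset.sum_const, nsmul_eq_mul, ENNReal.mul_rpow_of_nonneg _ _ (by positivity),
            ← ENNReal.rpow_mul, mul_one_div_cancel hq0.ne', ENNReal.rpow_one]
          rfl

lemma dec_nonempty {d n : ℕ} (Q : Fin n → QF d) (C : ℝ) (q p : ℝ≥0∞) (hq : 2 ≤ q) (hp : 2 ≤ p)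
    (k : ℕ) : ((2 : ℝ) ^ k) ^ d ∈ { D : ℝ | 0 ≤ D ∧
    ∀ f : (Fin d → Fin (2 ^ k)) → SchwartzMap ((Fin d → ℝ) × (Fin n → ℝ)) ℂ,
      (∀ ν, Function.support (fourierT (⇑(f ν))) ⊆ Ubox Q (1 / 2 ^ k) C (center k ν)) →
      eLpNorm (fun z => ∑ ν, f ν z) p volume ≤
        ENNReal.ofReal D * lqNorm q (fun ν => eLpNorm (⇑(f ν)) p volume) } := by
  refine ⟨by positivity, fun f _ => ?_⟩
  have h1 : (fun z => ∑ ν, f ν z) = ∑ ν, (⇑(f ν)) := by ext z; simp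
  rw [h1]
  refine (eLpNorm_sum_le (fun ν _ => (f ν).continuous.aestronglyMeasurable)
    (le_trans (by norm_num) hp)).trans ?_
  refine (Finset.sum_le_sum (fun ν _ => le_lqNorm q hq (fun ν => eLpNorm (⇑(f ν)) p volume) ν)).trans ?_
  rw [Finset.sum_const, nsmul_eq_mul]
  apply mul_le_mul_left
  rw [Finset.card_univ]
  simp

/-- Reduction of the statement to lower bounds for the decoupling constants. -/
lemma gamma_lower {d n : ℕ} (Q : Fin n → QF d) (C : ℝ) (q p : ℝ≥0∞) (hq : 2 ≤ q) (hp : 2 ≤ p)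
    (E c : ℝ) (hc : 0 < c)
    (h : ∀ k : ℕ, 1 ≤ k → ∀ D : ℝ, 0 ≤ D →
      (∀ f : (Fin d → Fin (2 ^ k)) → SchwartzMap ((Fin d → ℝ) × (Fin n → ℝ)) ℂ,
        (∀ ν, Function.support (fourierT (⇑(f ν))) ⊆ Ubox Q (1 / 2 ^ k) C (center k ν)) →
        eLpNorm (fun z => ∑ ν, f ν z) p volume ≤
          ENNReal.ofReal D * lqNorm q (fun ν => eLpNorm (⇑(f ν)) p volume)) →
      c * ((2 : ℝ) ^ k) ^ E ≤ D) : E ≤ Gamma Q C q p := by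
  have hpow : ∀ (k : ℕ) (x : ℝ), (1 / 2 ^ k : ℝ) ^ (-x) = ((2 : ℝ) ^ k) ^ x := by
    intro k x
    rw [one_div, Real.inv_rpow (by positivity), Real.rpow_neg (by positivity), inv_inv]
  apply le_csInf
  · refine ⟨d, fun ε hε => ⟨1, fun k hk => ?_⟩⟩
    have h1 : DecConst Q C q p k ≤ ((2 : ℝ) ^ k) ^ d :=
      csInf_le ⟨0, fun D hD => hD.1⟩ (dec_nonempty Q C q p hq hp k)
    refine h1.trans ?_
    rw [hpow, one_mul, ← Real.rpow_natCast]
    exact Real.rpow_le_rpow_of_exponent_le (one_le_pow₀ (by norm_num)) (by linarith)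
  · intro G hG
    apply le_of_forall_pos_le_add
    intro ε hε
    obtain ⟨Cε, hCε⟩ := hG ε hε
    have hlow : ∀ k : ℕ, 1 ≤ k → c * ((2 : ℝ) ^ k) ^ E ≤ DecConst Q C q p k := by
      intro k hk
      apply le_csInf ⟨_, dec_nonempty Q C q p hq hp k⟩
      intro D hD
      exact h k hk D hD.1 hD.2
    by_contra hlt
    push Not at hlt
    have hkey : ∀ k : ℕ, 1 ≤ k → ((2 : ℝ) ^ (E - (G + ε))) ^ k ≤ Cε / c := by
      intro k hk
      have h1 := (hlow k hk).trans (hCε k hk)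
      rw [hpow] at h1
      have h2 : ((2 : ℝ) ^ (E - (G + ε))) ^ k = ((2 : ℝ) ^ k) ^ E / ((2 : ℝ) ^ k) ^ (G + ε) := by
        rw [← Real.rpow_sub (by positivity), ← Real.rpow_natCast, ← Real.rpow_natCast,
          ← Real.rpow_mul (by norm_num), ← Real.rpow_mul (by norm_num), mul_comm]
      rw [h2, div_le_div_iff₀ (by positivity) hc]
      linarith
    have hbig : 1 < (2 : ℝ) ^ (E - (G + ε)) := Real.one_lt_rpow (by norm_num) (by linarith)
    obtain ⟨k, hk⟩ := pow_unbounded_of_one_lt (Cε / c) hbig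
    have h3 := hkey (k + 1) (by omega)
    have h4 : ((2 : ℝ) ^ (E - (G + ε))) ^ k ≤ ((2 : ℝ) ^ (E - (G + ε))) ^ (k + 1) :=
      pow_le_pow_right₀ hbig.le (by omega)
    linarith

/-- The shear `(x, y) ↦ (x + B y, y)`. -/
def shear {d n : ℕ} (B : (Fin n → ℝ) →ₗ[ℝ] (Fin d → ℝ)) :
    ((Fin d → ℝ) × (Fin n → ℝ)) →ₗ[ℝ] ((Fin d → ℝ) × (Fin n → ℝ)) :=
  (LinearMap.fst ℝ _ _ + B.comp (LinearMap.snd ℝ _ _)).prod (LinearMap.snd ℝ _ _)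

lemma abs_det_shear {d n : ℕ} (B : (Fin n → ℝ) →ₗ[ℝ] (Fin d → ℝ)) :
    |LinearMap.det (shear B)| = 1 := by
  have h1 : (shear B).comp (shear (-B)) = LinearMap.id := by
    ext <;> simp [shear]
  let c : ((Fin d → ℝ) × (Fin n → ℝ)) →ₗ[ℝ] ((Fin d → ℝ) × (Fin n → ℝ)) :=
    LinearMap.prodMap LinearMap.id (-LinearMap.id)
  have h2 : c.comp ((shear B).comp c) = shear (-B) := by
    ext <;> simp [shear, c]
  have h3 : c.comp c = LinearMap.id := by
    ext <;> simp [c]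
  have e1 := congrArg LinearMap.det h1
  have e2 := congrArg LinearMap.det h2
  have e3 := congrArg LinearMap.det h3
  rw [LinearMap.det_comp, LinearMap.det_id] at e1 e3
  rw [LinearMap.det_comp, LinearMap.det_comp] at e2
  have h4 : LinearMap.det (shear (-B)) = LinearMap.det (shear B) := by
    rw [← e2]; linear_combination (LinearMap.det (shear B)) * e3
  rw [h4] at e1
  have h5 : |LinearMap.det (shear B)| * |LinearMap.det (shear B)| = 1 := by
    rw [← abs_mul, e1, abs_one]
  nlinarith [abs_nonneg (LinearMap.det (shear B))]

lemma exists_map {d n : ℕ} (M : Matrix (Fin d) (Fin d) ℝ) (hM : IsUnit M.det)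
    (N : (Fin n → ℝ) ≃ₗ[ℝ] (Fin n → ℝ)) :
    ∃ J : ℝ, 0 < J ∧ ∀ (w : Fin d → ℝ), (∀ j, 0 < w j) → ∀ t : ℝ, 0 < t →
      ∀ B : (Fin n → ℝ) →ₗ[ℝ] (Fin d → ℝ),
      ∃ A : ((Fin d → ℝ) × (Fin n → ℝ)) ≃L[ℝ] ((Fin d → ℝ) × (Fin n → ℝ)),
        (∀ z, A z = (fun j => w j * ((M.mulVec z.1) j + B z.2 j), fun i => t * N.symm z.2 i)) ∧
        Measure.map A (volume : Measure ((Fin d → ℝ) × (Fin n → ℝ)))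
          = ENNReal.ofReal (J / ((∏ j, w j) * t ^ n)) • volume := by
  have hN : LinearMap.det (N.symm : (Fin n → ℝ) →ₗ[ℝ] (Fin n → ℝ)) ≠ 0 :=
    (LinearEquiv.isUnit_det' N.symm).ne_zero
  refine ⟨|M.det * LinearMap.det (N.symm : (Fin n → ℝ) →ₗ[ℝ] (Fin n → ℝ))|⁻¹,
    inv_pos.mpr (abs_pos.mpr (mul_ne_zero hM.ne_zero hN)), ?_⟩
  intro w hw t ht B
  let A0 : ((Fin d → ℝ) × (Fin n → ℝ)) →ₗ[ℝ] ((Fin d → ℝ) × (Fin n → ℝ)) :=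
    (LinearMap.prodMap (Matrix.toLin' (Matrix.diagonal w))
      (t • (N.symm : (Fin n → ℝ) →ₗ[ℝ] (Fin n → ℝ)))).comp
      ((shear B).comp (LinearMap.prodMap (Matrix.toLin' M) LinearMap.id))
  have hA0 : ∀ z, A0 z = (fun j => w j * ((M.mulVec z.1) j + B z.2 j),
      fun i => t * N.symm z.2 i) := by
    intro z
    ext j
    · simp [A0, shear, Matrix.mulVec_diagonal]
    · simp [A0, shear]
  have hdet : |LinearMap.det A0| = ((∏ j, w j) * t ^ n) *
      |M.det * LinearMap.det (N.symm : (Fin n → ℝ) →ₗ[ℝ] (Fin n → ℝ))| := by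
    simp only [A0]
    rw [LinearMap.det_comp, LinearMap.det_comp, LinearMap.det_prodMap, LinearMap.det_prodMap,
      abs_mul, abs_mul (LinearMap.det (shear B)), abs_det_shear, LinearMap.det_smul,
      LinearMap.det_toLin', LinearMap.det_toLin', Matrix.det_diagonal, LinearMap.det_id,
      Module.finrank_fin_fun]
    simp only [abs_mul, abs_pow, abs_of_pos ht, one_mul, mul_one,
      abs_of_pos (Finset.prod_pos fun j _ => hw j)]
    ring
  have hpos : 0 < (∏ j, w j) * t ^ n := mul_pos (Finset.prod_pos fun j _ => hw j) (by positivity)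
  have hne : LinearMap.det A0 ≠ 0 := by
    rw [← abs_pos, hdet]
    exact mul_pos hpos (abs_pos.mpr (mul_ne_zero hM.ne_zero hN))
  refine ⟨(LinearMap.equivOfDetNeZero A0 hne).toContinuousLinearEquiv, fun z => hA0 z, ?_⟩
  have := Measure.map_linearMap_addHaar_eq_smul_addHaar
    (volume : Measure ((Fin d → ℝ) × (Fin n → ℝ))) hne
  refine Eq.trans (?_ : _ = Measure.map A0 volume) (this.trans ?_)
  · rfl
  · congr 2
    rw [abs_inv, hdet]
    field_simp

lemma eLpNorm_packet {d n : ℕ} (φ : SchwartzMap ((Fin d → ℝ) × (Fin n → ℝ)) ℂ)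
    (A : ((Fin d → ℝ) × (Fin n → ℝ)) ≃L[ℝ] ((Fin d → ℝ) × (Fin n → ℝ)))
    (f : ((Fin d → ℝ) × (Fin n → ℝ)) → ℂ) (hf : ∀ z, ‖f z‖ = ‖φ (A z)‖) (c : ℝ) (hc : 0 < c)
    (hA : Measure.map A (volume : Measure ((Fin d → ℝ) × (Fin n → ℝ)))
          = ENNReal.ofReal c • volume) (p : ℝ≥0∞) :
    eLpNorm f p volume = ENNReal.ofReal c ^ (1 / p.toReal) * eLpNorm φ p volume := by
  have h1 : eLpNorm f p volume = eLpNorm (φ ∘ A) p volume :=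
    eLpNorm_congr_norm_ae (Filter.Eventually.of_forall hf)
  rw [h1, ← eLpNorm_map_measure φ.continuous.aestronglyMeasurable A.continuous.measurable.aemeasurable,
    hA, eLpNorm_smul_measure_of_ne_zero (by simpa using hc), smul_eq_mul]
  simp

lemma volume_region {d n : ℕ}
    (A : ((Fin d → ℝ) × (Fin n → ℝ)) ≃L[ℝ] ((Fin d → ℝ) × (Fin n → ℝ))) (c : ℝ)
    (hA : Measure.map A (volume : Measure ((Fin d → ℝ) × (Fin n → ℝ)))
          = ENNReal.ofReal c • volume) (hc : 0 < c) (a : Fin d → ℝ) (b : Fin n → ℝ)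
    (ha : ∀ j, 0 < a j) (hb : ∀ i, 0 < b i) :
    MeasurableSet {z | (∀ j, |(A z).1 j| ≤ a j) ∧ ∀ i, |(A z).2 i| ≤ b i} ∧
    volume {z | (∀ j, |(A z).1 j| ≤ a j) ∧ ∀ i, |(A z).2 i| ≤ b i}
      = ENNReal.ofReal (c * ((∏ j, (2 * a j)) * ∏ i, (2 * b i))) := by
  have hset : {z | (∀ j, |(A z).1 j| ≤ a j) ∧ ∀ i, |(A z).2 i| ≤ b i}
      = A ⁻¹' (Set.Icc (-a) a ×ˢ Set.Icc (-b) b) := by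
    ext z
    simp only [Set.mem_ofPred_eq, Set.mem_preimage, Set.mem_prod, Set.mem_Icc, Pi.le_def, abs_le,
      Pi.neg_apply, forall_and]
  have hms : MeasurableSet (Set.Icc (-a) a ×ˢ Set.Icc (-b) b) :=
    measurableSet_Icc.prod measurableSet_Icc
  rw [hset]
  refine ⟨A.continuous.measurable hms, ?_⟩
  rw [← Measure.map_apply A.continuous.measurable hms, hA, Measure.smul_apply, smul_eq_mul,
    Measure.volume_eq_prod, Measure.prod_prod, Real.volume_Icc_pi, Real.volume_Icc_pi,
    ← ENNReal.ofReal_prod_of_nonneg, ← ENNReal.ofReal_prod_of_nonneg,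
    ← ENNReal.ofReal_mul, ← ENNReal.ofReal_mul hc.le]
  · simp only [Pi.neg_apply, sub_neg_eq_add, two_mul]
  · exact Finset.prod_nonneg fun j _ => by simp [(ha j).le]
  · intro i _; simp [(hb i).le]
  · intro i _; simp [(ha i).le]

lemma eLpNorm_lower {α : Type*} [MeasurableSpace α] (μ : Measure α) (R : Set α)
    (V b : ℝ) (hV : 0 < V) (hR : μ R = ENNReal.ofReal V) (hb : 0 ≤ b) (F : α → ℂ)
    (hF : AEStronglyMeasurable F μ)
    (h : ENNReal.ofReal (V * b ^ 2) ≤ ∫⁻ z in R, ‖F z‖ₑ ^ 2 ∂μ) (p : ℝ≥0∞) (hp : 2 ≤ p) :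
    ENNReal.ofReal (V ^ (1 / p.toReal) * b) ≤ eLpNorm F p μ := by
  have h1 : eLpNorm F 2 (μ.restrict R) = (∫⁻ z in R, ‖F z‖ₑ ^ 2 ∂μ) ^ (1 / 2 : ℝ) := by
    rw [eLpNorm_eq_lintegral_rpow_enorm_toReal (by norm_num) (by norm_num)]
    simp
  have h2 := eLpNorm_le_eLpNorm_mul_rpow_measure_univ hp (hF.restrict (s := R))
  have h3 : ENNReal.ofReal (V ^ (1 / 2 : ℝ) * b) ≤ eLpNorm F 2 (μ.restrict R) := by
    rw [h1]
    refine le_trans (le_of_eq ?_) (ENNReal.rpow_le_rpow h (by norm_num))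
    rw [ENNReal.ofReal_rpow_of_nonneg (by positivity) (by norm_num),
      Real.mul_rpow hV.le (by positivity)]
    congr 2
    rw [← Real.sqrt_eq_rpow, Real.sqrt_sq hb]
  have h4 : eLpNorm F p (μ.restrict R) ≤ eLpNorm F p μ := eLpNorm_restrict_le F p μ R
  have h5 := (h3.trans h2).trans (mul_le_mul_left h4 _)
  rw [Measure.restrict_apply_univ, hR, ENNReal.ofReal_rpow_of_pos hV] at h5
  have hVp : 0 < V ^ (1 / (2 : ℝ≥0∞).toReal - 1 / p.toReal) := Real.rpow_pos_of_pos hV _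
  have h6 := ENNReal.div_le_of_le_mul h5
  rw [← ENNReal.ofReal_div_of_pos hVp] at h6
  refine le_trans (le_of_eq ?_) h6
  congr 1
  rw [Real.rpow_sub hV]
  simp only [ENNReal.toReal_ofNat]
  have := (Real.rpow_pos_of_pos hV (1 / 2 : ℝ)).ne'
  field_simp

lemma linear_bound {a b : ℕ} (L : (Fin a → ℝ) →ₗ[ℝ] (Fin b → ℝ)) :
    ∃ K : ℝ, 0 ≤ K ∧ ∀ (x : Fin a → ℝ) (c : ℝ), 0 ≤ c → (∀ j, |x j| ≤ c) → ∀ i, |L x i| ≤ K * c := by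
  refine ⟨‖L.toContinuousLinearMap‖, norm_nonneg _, fun x c hc hx i => ?_⟩
  have h1 : ‖x‖ ≤ c := (pi_norm_le_iff_of_nonneg hc).mpr (by simpa using hx)
  have h2 := (L.toContinuousLinearMap).le_opNorm x
  have h3 : |L x i| ≤ ‖L x‖ := by simpa using norm_le_pi_norm (L x) i
  exact h3.trans (h2.trans (mul_le_mul_of_nonneg_left h1 (norm_nonneg _)))

lemma polar_bound {d : ℕ} (Q : QF d) :
    ∃ K : ℝ, 0 ≤ K ∧ ∀ (x y : Fin d → ℝ) (c c' : ℝ), 0 ≤ c → 0 ≤ c' → (∀ j, |x j| ≤ c) →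
      (∀ j, |y j| ≤ c') → |QuadraticMap.polar (⇑Q) x y| ≤ K * c * c' := by
  let T : (Fin d → ℝ) →L[ℝ] (Fin d → ℝ) →L[ℝ] ℝ :=
    ((LinearMap.toContinuousLinearMap :
      ((Fin d → ℝ) →ₗ[ℝ] ℝ) ≃ₗ[ℝ] ((Fin d → ℝ) →L[ℝ] ℝ)).toLinearMap.comp
        (QuadraticMap.polarBilin Q)).toContinuousLinearMap
  refine ⟨‖T‖, T.opNorm_nonneg, fun x y c c' hc hc' hx hy => ?_⟩
  have h1 : ‖x‖ ≤ c := (pi_norm_le_iff_of_nonneg hc).mpr (by simpa using hx)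
  have h1' : ‖y‖ ≤ c' := (pi_norm_le_iff_of_nonneg hc').mpr (by simpa using hy)
  have h2 : ‖T x y‖ ≤ ‖T‖ * ‖x‖ * ‖y‖ := T.le_opNorm₂ x y
  have h3 : QuadraticMap.polar (⇑Q) x y = T x y := rfl
  rw [h3, ← Real.norm_eq_abs]
  refine h2.trans ?_
  gcongr

/-- All size constants at once. -/
lemma exists_bounds {d n : ℕ} (Q : Fin n → QF d) (M : Matrix (Fin d) (Fin d) ℝ)
    (N : (Fin n → ℝ) ≃ₗ[ℝ] (Fin n → ℝ)) :
    ∃ K : ℝ, 1 ≤ K ∧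
      (∀ (x : Fin d → ℝ) (c : ℝ), 0 ≤ c → (∀ j, |x j| ≤ c) → ∀ j, |Matrix.vecMul x M j| ≤ K * c) ∧
      (∀ (x : Fin d → ℝ) (c : ℝ), 0 ≤ c → (∀ j, |x j| ≤ c) → ∀ j, |Matrix.vecMul x M⁻¹ j| ≤ K * c) ∧
      (∀ (x : Fin n → ℝ) (c : ℝ), 0 ≤ c → (∀ j, |x j| ≤ c) → ∀ j, |N x j| ≤ K * c) ∧
      (∀ (x : Fin n → ℝ) (c : ℝ), 0 ≤ c → (∀ j, |x j| ≤ c) →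
        ∀ i, |∑ l, N.symm (Pi.single i 1) l * x l| ≤ K * c) ∧
      (∀ i (x y : Fin d → ℝ) (c c' : ℝ), 0 ≤ c → 0 ≤ c' → (∀ j, |x j| ≤ c) →
        (∀ j, |y j| ≤ c') → |QuadraticMap.polar (⇑(Q i)) x y| ≤ K * c * c') ∧
      (∀ i (x : Fin d → ℝ) (c : ℝ), 0 ≤ c → (∀ j, |x j| ≤ c) → |Q i x| ≤ K * c ^ 2) := by
  obtain ⟨K1, h1, H1⟩ := linear_bound (Matrix.vecMulLinear M)
  obtain ⟨K2, h2, H2⟩ := linear_bound (Matrix.vecMulLinear M⁻¹)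
  obtain ⟨K3, h3, H3⟩ := linear_bound (N : (Fin n → ℝ) →ₗ[ℝ] (Fin n → ℝ))
  obtain ⟨K4, h4, H4⟩ := linear_bound (Matrix.mulVecLin
    (Matrix.of fun i l => N.symm (Pi.single i 1) l))
  choose K5 h5 H5 using fun i => polar_bound (Q i)
  have hs : 0 ≤ ∑ i, K5 i := Finset.sum_nonneg fun i _ => h5 i
  have H5' : ∀ i (x y : Fin d → ℝ) (c c' : ℝ), 0 ≤ c → 0 ≤ c' → (∀ j, |x j| ≤ c) →
        (∀ j, |y j| ≤ c') →
        |QuadraticMap.polar (⇑(Q i)) x y| ≤ (1 + K1 + K2 + K3 + K4 + ∑ i, K5 i) * c * c' := by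
    intro i x y c c' hc hc' hx hy
    refine (H5 i x y c c' hc hc' hx hy).trans ?_
    have : K5 i ≤ ∑ i, K5 i := Finset.single_le_sum (fun i _ => h5 i) (Finset.mem_univ i)
    gcongr
    linarith
  refine ⟨1 + K1 + K2 + K3 + K4 + ∑ i, K5 i, by linarith, ?_, ?_, ?_, ?_, H5', ?_⟩
  · intro x c hc hx j
    exact (H1 x c hc hx j).trans (mul_le_mul_of_nonneg_right (by linarith) hc)
  · intro x c hc hx j
    exact (H2 x c hc hx j).trans (mul_le_mul_of_nonneg_right (by linarith) hc)
  · intro x c hc hx j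
    exact (H3 x c hc hx j).trans (mul_le_mul_of_nonneg_right (by linarith) hc)
  · intro x c hc hx j
    exact (H4 x c hc hx j).trans (mul_le_mul_of_nonneg_right (by linarith) hc)
  · intro i x c hc hx
    have hp := H5' i x x c c hc hc hx hx
    have e : QuadraticMap.polar (⇑(Q i)) x x = 2 * Q i x := by
      rw [QuadraticMap.polar_self]; simp
    rw [e, abs_mul, abs_two] at hp
    have : 0 ≤ |Q i x| := abs_nonneg _
    nlinarith

lemma polar_vecMul {d : ℕ} (Q : QF d) (M : Matrix (Fin d) (Fin d) ℝ) (a g : Fin d → ℝ) :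
    QuadraticMap.polar (⇑Q) a (Matrix.vecMul g M)
      = ∑ j, g j * QuadraticMap.polar (⇑Q) a (Matrix.vecMul (Pi.single j 1) M) := by
  let L : (Fin d → ℝ) →ₗ[ℝ] ℝ := (QuadraticMap.polarBilin Q a).comp (Matrix.vecMulLinear M)
  have hL : ∀ g, L g = QuadraticMap.polar (⇑Q) a (Matrix.vecMul g M) := fun g => rfl
  simp only [← hL]
  conv_lhs => rw [pi_eq_sum_univ' g, map_sum]
  refine Finset.sum_congr rfl fun j _ => ?_
  rw [map_smul, smul_eq_mul]

/-- The tilting of the packet attached to the point `a`, in the directions outside `S`. -/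
def Bmap {d n : ℕ} (Q : Fin n → QF d) (M : Matrix (Fin d) (Fin d) ℝ) (S : Finset (Fin d))
    (a : Fin d → ℝ) : (Fin n → ℝ) →ₗ[ℝ] (Fin d → ℝ) where
  toFun y j := if j ∈ S then 0 else
    ∑ i, y i * QuadraticMap.polar (⇑(Q i)) a (Matrix.vecMul (Pi.single j 1) M)
  map_add' x y := by
    ext j
    by_cases hj : j ∈ S <;> simp [hj, add_mul, Finset.sum_add_distrib]
  map_smul' c y := by
    ext j
    by_cases hj : j ∈ S <;> simp [hj, Finset.mul_sum, mul_assoc]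

lemma support_lemma {d n : ℕ} (Q : Fin n → QF d) (M : Matrix (Fin d) (Fin d) ℝ)
    (N : (Fin n → ℝ) ≃ₗ[ℝ] (Fin n → ℝ)) (S : Finset (Fin d)) (K : ℝ) (hK : 1 ≤ K)
    (hK1 : ∀ (x : Fin d → ℝ) (c : ℝ), 0 ≤ c → (∀ j, |x j| ≤ c) →
      ∀ j, |Matrix.vecMul x M j| ≤ K * c)
    (hK4 : ∀ (x : Fin n → ℝ) (c : ℝ), 0 ≤ c → (∀ j, |x j| ≤ c) →
        ∀ i, |∑ l, N.symm (Pi.single i 1) l * x l| ≤ K * c)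
    (hK5 : ∀ i (x y : Fin d → ℝ) (c c' : ℝ), 0 ≤ c → 0 ≤ c' → (∀ j, |x j| ≤ c) →
        (∀ j, |y j| ≤ c') → |QuadraticMap.polar (⇑(Q i)) x y| ≤ K * c * c')
    (hK6 : ∀ i (x : Fin d → ℝ) (c : ℝ), 0 ≤ c → (∀ j, |x j| ≤ c) → |Q i x| ≤ K * c ^ 2)
    (δ h ρ Cb : ℝ) (hδ : 0 < δ) (hδ1 : δ ≤ 1) (hh : 0 ≤ h) (hρ : 0 ≤ ρ) (hCb : 1 ≤ Cb)
    (hb1 : K * (h + ρ) ≤ 1) (hb2 : K * (K * h) ^ 2 + K * (K * ρ) + K * ρ ≤ 1)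
    (a ξ ξt : Fin d → ℝ) (ha : a = Matrix.vecMul ξ M) (ha1 : ∀ j, |a j| ≤ 1)
    (hξ : ∀ j, |ξt j - ξ j| ≤ h * δ)
    (ζ κ : (Fin d → ℝ) × (Fin n → ℝ)) (hκ1 : ∀ j, |κ.1 j| ≤ ρ) (hκ2 : ∀ i, |κ.2 i| ≤ ρ)
    (A : ((Fin d → ℝ) × (Fin n → ℝ)) → ((Fin d → ℝ) × (Fin n → ℝ)))
    (hA : ∀ z, A z = (fun j => (if j ∈ S then δ ^ 2 else δ) *
      ((M.mulVec z.1) j + Bmap Q M S a z.2 j), fun i => δ ^ 2 * N.symm z.2 i))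
    (hζ : ∀ z, dot z (ζ - (Matrix.vecMul ξt M, fun i => Q i (Matrix.vecMul ξt M)))
      = dot (A z) κ) :
    ζ ∈ Ubox Q δ Cb a := by
  set ω := Matrix.vecMul ξt M with hω
  set W : Fin d → ℝ := fun j => (if j ∈ S then δ ^ 2 else δ) * κ.1 j with hW
  set g : Fin d → ℝ := fun j => if j ∈ S then 0 else δ * κ.1 j with hg
  set g' : Fin d → ℝ := fun j => if j ∈ S then δ ^ 2 * κ.1 j else 0 with hg'
  have hWg : W = g + g' := by
    ext j; by_cases hj : j ∈ S <;> simp [hW, hg, hg', hj]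
  have h1 : ∀ j, ζ.1 j - ω j = Matrix.vecMul W M j := by
    intro j
    have := hζ (Pi.single j 1, 0)
    rw [hA] at this
    simp only [dot, Pi.zero_apply, zero_mul, Finset.sum_const_zero, add_zero, map_zero,
      mul_zero] at this
    simp [Pi.single_apply] at this
    rw [this]
    simp only [Matrix.vecMul, dotProduct, hW]
    exact Finset.sum_congr rfl fun l _ => by split_ifs <;> ring
  have h2 : ∀ i, ζ.2 i - Q i ω = QuadraticMap.polar (⇑(Q i)) a (Matrix.vecMul g M)
      + δ ^ 2 * ∑ l, N.symm (Pi.single i 1) l * κ.2 l := by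
    intro i
    have := hζ (0, Pi.single i 1)
    rw [hA] at this
    simp only [dot, Pi.zero_apply, zero_mul, Finset.sum_const_zero, zero_add, Matrix.mulVec_zero]
      at this
    have e : ∑ l, (Pi.single i 1 : Fin n → ℝ) l * (ζ - (ω, fun i => Q i ω)).2 l
        = ζ.2 i - Q i ω := by simp [Pi.single_apply]
    rw [e] at this
    rw [this, polar_vecMul, Finset.mul_sum]
    congr 1
    · refine Finset.sum_congr rfl fun j _ => ?_
      by_cases hj : j ∈ S
      · simp [hg, hj, Bmap]
      · simp [hg, hj, Bmap, Pi.single_apply]; ring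
    · exact Finset.sum_congr rfl fun l _ => by ring
  have hωa : ω - a = Matrix.vecMul (ξt - ξ) M := by rw [Matrix.sub_vecMul, ← ha]
  have hω1 : ∀ j, |(ω - a) j| ≤ K * (h * δ) := by
    rw [hωa]; exact hK1 _ _ (by positivity) hξ
  have hδ2 : δ ^ 2 ≤ δ := by nlinarith
  have hW1 : ∀ j, |W j| ≤ δ * ρ := by
    intro j
    simp only [hW, abs_mul]
    refine mul_le_mul ?_ (hκ1 j) (abs_nonneg _) hδ.le
    by_cases hj : j ∈ S
    · simp only [hj, if_true]; rw [abs_of_pos (by positivity)]; exact hδ2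
    · simp only [hj, if_false]; rw [abs_of_pos hδ]
  have hu : ∀ j, |ζ.1 j - a j| ≤ δ := by
    intro j
    have e : ζ.1 j - a j = (ω - a) j + Matrix.vecMul W M j := by
      rw [← h1]; simp
    have := hK1 W (δ * ρ) (by positivity) hW1 j
    rw [e]
    refine (abs_add_le _ _).trans ((add_le_add (hω1 j) this).trans ?_)
    nlinarith
  have hg'1 : ∀ j, |g' j| ≤ δ ^ 2 * ρ := by
    intro j
    by_cases hj : j ∈ S
    · simp only [hg', hj, if_true, abs_mul]
      rw [abs_of_pos (show 0 < δ ^ 2 by positivity)]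
      exact mul_le_mul_of_nonneg_left (hκ1 j) (by positivity)
    · simp only [hg', hj, if_false, abs_zero]; positivity
  set x := ζ.1 - a with hx
  have hxe : x = (ω - a) + Matrix.vecMul g M + Matrix.vecMul g' M := by
    rw [add_assoc, ← Matrix.add_vecMul, ← hWg]
    ext j
    rw [Pi.add_apply, ← h1]; simp [hx]
  have hv : ∀ i, |ζ.2 i - Q i a - QuadraticMap.polar (⇑(Q i)) a x| ≤ δ ^ 2 := by
    intro i
    have e1 : Q i ω = Q i a + Q i (ω - a) + QuadraticMap.polar (⇑(Q i)) a (ω - a) := by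
      simp [QuadraticMap.polar]
    have e2 : ζ.2 i - Q i a - QuadraticMap.polar (⇑(Q i)) a x
        = Q i (ω - a) - QuadraticMap.polar (⇑(Q i)) a (Matrix.vecMul g' M)
          + δ ^ 2 * ∑ l, N.symm (Pi.single i 1) l * κ.2 l := by
      rw [hxe, QuadraticMap.polar_add_right, QuadraticMap.polar_add_right]
      linarith [h2 i]
    have b1 := hK6 i (ω - a) _ (by positivity) hω1
    have b2 := hK5 i a (Matrix.vecMul g' M) 1 (K * (δ ^ 2 * ρ)) zero_le_one (by positivity) ha1
      (hK1 g' _ (by positivity) hg'1)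
    have b3 := hK4 κ.2 ρ hρ hκ2 i
    rw [e2]
    have b4 : |δ ^ 2 * ∑ l, N.symm (Pi.single i 1) l * κ.2 l| ≤ δ ^ 2 * (K * ρ) := by
      rw [abs_mul, abs_of_pos (show 0 < δ ^ 2 by positivity)]
      exact mul_le_mul_of_nonneg_left b3 (by positivity)
    refine (abs_add_le _ _).trans ((add_le_add (abs_sub _ _) b4).trans ?_)
    have : δ ^ 2 * (K * (K * h) ^ 2 + K * (K * ρ) + K * ρ) ≤ δ ^ 2 * 1 :=
      mul_le_mul_of_nonneg_left hb2 (by positivity)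
    nlinarith
  refine ⟨fun j => (ζ.1 j - a j) / δ,
    fun i => (ζ.2 i - Q i a - QuadraticMap.polar (⇑(Q i)) a x) / δ ^ 2, ?_, ?_, ?_, ?_⟩
  · intro j
    rw [abs_div, abs_of_pos hδ]
    exact ((div_le_one hδ).mpr (hu j)).trans hCb
  · intro i
    rw [abs_div, abs_of_pos (show 0 < δ ^ 2 by positivity)]
    exact ((div_le_one (by positivity)).mpr (hv i)).trans hCb
  · ext j; field_simp; ring
  · ext i
    have e : δ • (fun j => (ζ.1 j - a j) / δ) = x := by
      ext j; simp [hx]; field_simp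
    rw [e]; field_simp; ring

lemma region_lemma {d n : ℕ} (Q : Fin n → QF d) (M : Matrix (Fin d) (Fin d) ℝ)
    (N : (Fin n → ℝ) ≃ₗ[ℝ] (Fin n → ℝ)) (S : Finset (Fin d)) (S' : Finset (Fin n))
    (hS : ∀ τ : Fin n → ℝ, (∀ i, i ∉ S' → τ i = 0) → ∀ ξ ξ' : Fin d → ℝ,
      (∀ j ∈ S, ξ j = ξ' j) →
      ∑ i, N τ i * Q i (Matrix.vecMul ξ M) = ∑ i, N τ i * Q i (Matrix.vecMul ξ' M))
    (K : ℝ) (hK : 1 ≤ K)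
    (hK1 : ∀ (x : Fin d → ℝ) (c : ℝ), 0 ≤ c → (∀ j, |x j| ≤ c) →
      ∀ j, |Matrix.vecMul x M j| ≤ K * c)
    (hK3 : ∀ (x : Fin n → ℝ) (c : ℝ), 0 ≤ c → (∀ j, |x j| ≤ c) → ∀ j, |N x j| ≤ K * c)
    (hK5 : ∀ i (x y : Fin d → ℝ) (c c' : ℝ), 0 ≤ c → 0 ≤ c' → (∀ j, |x j| ≤ c) →
        (∀ j, |y j| ≤ c') → |QuadraticMap.polar (⇑(Q i)) x y| ≤ K * c * c')
    (hK6 : ∀ i (x : Fin d → ℝ) (c : ℝ), 0 ≤ c → (∀ j, |x j| ≤ c) → |Q i x| ≤ K * c ^ 2)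
    (δ r : ℝ) (hδ : 0 < δ) (hδ1 : δ ≤ 1) (hr : 0 ≤ r) (z : (Fin d → ℝ) × (Fin n → ℝ))
    (hz1 : ∀ j, |(M.mulVec z.1) j| ≤ r * (if j ∈ S then (δ ^ 2)⁻¹ else 1))
    (hz2 : ∀ i, |N.symm z.2 i| ≤ r * (if i ∈ S' then (δ ^ 2)⁻¹ else 1)) :
    (∀ ξt : Fin d → ℝ, (∀ j, |ξt j| ≤ 2 * K) →
      |dot z (Matrix.vecMul ξt M, fun i => Q i (Matrix.vecMul ξt M))
        - (dot z (Matrix.vecMul (fun j => if j ∈ S then ξt j else 0) M, 0)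
          + ∑ i, N (fun i => if i ∈ S' then N.symm z.2 i else 0) i *
            Q i (Matrix.vecMul (fun j => if j ∈ S then ξt j else 0) M))|
        ≤ r * (2 * d * K + 4 * n * K ^ 6)) ∧
    ∀ (a ξ : Fin d → ℝ), a = Matrix.vecMul ξ M → (∀ j, |a j| ≤ 1) →
      (∀ j, |(if j ∈ S then δ ^ 2 else δ) * ((M.mulVec z.1) j + Bmap Q M S a z.2 j)|
        ≤ r * (1 + n * K ^ 3)) ∧ ∀ i, |δ ^ 2 * N.symm z.2 i| ≤ r * (1 + n * K ^ 3) := by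
  have hK0 : 0 ≤ K := by linarith
  have hδ2 : 0 < δ ^ 2 := by positivity
  have hδ21 : δ ^ 2 ≤ 1 := by nlinarith
  set τ := N.symm z.2 with hτ
  set τ1 : Fin n → ℝ := fun i => if i ∈ S' then τ i else 0 with hτ1
  set τ2 : Fin n → ℝ := fun i => if i ∈ S' then 0 else τ i with hτ2
  have hτs : τ = τ1 + τ2 := by
    ext i; by_cases hi : i ∈ S' <;> simp [hτ1, hτ2, hi]
  have hy : z.2 = N τ1 + N τ2 := by
    rw [← map_add, ← hτs, hτ, LinearEquiv.apply_symm_apply]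
  have hτ2b : ∀ i, |τ2 i| ≤ r := by
    intro i
    have := hz2 i
    by_cases hi : i ∈ S'
    · simp [hτ2, hi, hr]
    · simpa [hτ2, hi] using this
  have hN2 := hK3 τ2 r hr hτ2b
  have hτ10 : ∀ i, i ∉ S' → τ1 i = 0 := fun i hi => by simp [hτ1, hi]
  have hsum : ∀ (f : Fin n → ℝ) (c : ℝ), 0 ≤ c → (∀ i, |f i| ≤ c) →
      |∑ i, N τ2 i * f i| ≤ n * (K * r * c) := by
    intro f c hc hf
    refine (Finset.abs_sum_le_sum_abs _ _).trans ?_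
    refine (Finset.sum_le_card_nsmul _ _ (K * r * c) fun i _ => ?_).trans ?_
    · rw [abs_mul]
      exact mul_le_mul (hN2 i) (hf i) (abs_nonneg _) (by positivity)
    · simp
  constructor
  · intro ξt hξt
    set η : Fin d → ℝ := fun j => if j ∈ S then ξt j else 0 with hη
    set ω := Matrix.vecMul ξt M with hω
    have hdot : ∀ v : Fin d → ℝ, ∑ j, z.1 j * Matrix.vecMul v M j = ∑ j, v j * M.mulVec z.1 j := by
      intro v
      have := Matrix.dotProduct_mulVec v M z.1
      simp only [dotProduct] at this
      rw [this]
      exact Finset.sum_congr rfl fun l _ => mul_comm _ _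
    have e1 := hS τ1 hτ10 ξt η (fun j hj => by simp [hη, hj])
    have e2 : ∑ i, z.2 i * Q i ω = ∑ i, N τ1 i * Q i ω + ∑ i, N τ2 i * Q i ω := by
      rw [← Finset.sum_add_distrib]
      refine Finset.sum_congr rfl fun i _ => ?_
      rw [hy, Pi.add_apply]; ring
    have e3 : ∑ j, ξt j * M.mulVec z.1 j - ∑ j, η j * M.mulVec z.1 j
        = ∑ j, (if j ∈ S then 0 else ξt j) * M.mulVec z.1 j := by
      rw [← Finset.sum_sub_distrib]
      refine Finset.sum_congr rfl fun j _ => ?_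
      by_cases hj : j ∈ S <;> simp [hη, hj]
    have e4 : dot z (ω, fun i => Q i ω) - (dot z (Matrix.vecMul η M, 0)
          + ∑ i, N τ1 i * Q i (Matrix.vecMul η M))
        = (∑ j, (if j ∈ S then 0 else ξt j) * M.mulVec z.1 j) + ∑ i, N τ2 i * Q i ω := by
      rw [← e3, ← e1]
      simp only [dot, hdot, hω, Pi.zero_apply, mul_zero, Finset.sum_const_zero, add_zero]
      rw [← hω, e2]
      ring
    rw [e4]
    have b1 : |∑ j, (if j ∈ S then 0 else ξt j) * M.mulVec z.1 j| ≤ d * (2 * K * r) := by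
      refine (Finset.abs_sum_le_sum_abs _ _).trans ?_
      refine (Finset.sum_le_card_nsmul _ _ (2 * K * r) fun j _ => ?_).trans ?_
      · have := hz1 j
        by_cases hj : j ∈ S
        · simp only [hj, if_true, zero_mul, abs_zero]; positivity
        · simp only [hj, if_false, mul_one, abs_mul] at this ⊢
          exact mul_le_mul (hξt j) this (abs_nonneg _) (by positivity)
      · simp
    have b2 := hsum (fun i => Q i ω) (K * (K * (2 * K)) ^ 2) (by positivity)
      (fun i => hK6 i ω _ (by positivity) (hK1 ξt _ (by positivity) hξt))
    refine (abs_add_le _ _).trans ((add_le_add b1 b2).trans (le_of_eq ?_))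
    ring
  · intro a ξ haξ ha1
    have hnK : 0 ≤ (n : ℝ) * K ^ 3 := by positivity
    constructor
    · intro j
      by_cases hj : j ∈ S
      · have := hz1 j
        simp only [hj, if_true] at this ⊢
        have e : Bmap Q M S a z.2 j = 0 := by simp [Bmap, hj]
        rw [e, add_zero, abs_mul, abs_of_pos hδ2]
        have h3 := mul_le_mul_of_nonneg_left this hδ2.le
        have e5 : δ ^ 2 * (r * (δ ^ 2)⁻¹) = r := by field_simp
        rw [e5] at h3
        nlinarith
      · have := hz1 j
        simp only [hj, if_false, mul_one] at this ⊢
        set ej : Fin d → ℝ := Pi.single j 1 with hej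
        have hejS : ∀ l ∈ S, ej l = 0 := by
          intro l hl
          have : l ≠ j := fun h => hj (h ▸ hl)
          simp [hej, this]
        have c1 := hS τ1 hτ10 (ξ + ej) ξ (fun l hl => by simp [hejS l hl])
        have c2 := hS τ1 hτ10 ej 0 (fun l hl => by simp [hejS l hl])
        have c3 : ∑ i, N τ1 i * QuadraticMap.polar (⇑(Q i)) a (Matrix.vecMul ej M) = 0 := by
          simp only [QuadraticMap.polar, mul_sub, Finset.sum_sub_distrib, haξ,
            ← Matrix.add_vecMul]
          rw [c1, c2]
          simp
        have e : Bmap Q M S a z.2 j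
            = ∑ i, N τ2 i * QuadraticMap.polar (⇑(Q i)) a (Matrix.vecMul ej M) := by
          have : Bmap Q M S a z.2 j
            = ∑ i, z.2 i * QuadraticMap.polar (⇑(Q i)) a (Matrix.vecMul ej M) := by
            simp [Bmap, hj, hej]
          rw [this, hy]
          simp only [Pi.add_apply, add_mul, Finset.sum_add_distrib, c3, zero_add]
        have hej1 : ∀ l, |ej l| ≤ 1 := by
          intro l
          by_cases hl : l = j
          · subst hl; simp [hej]
          · simp [hej, hl]
        have b := hsum (fun i => QuadraticMap.polar (⇑(Q i)) a (Matrix.vecMul ej M))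
          (K * 1 * (K * 1)) (by positivity)
          (fun i => hK5 i a _ 1 (K * 1) zero_le_one (by positivity) ha1
            (hK1 ej 1 zero_le_one hej1))
        rw [← e] at b
        have b' := (abs_add_le (M.mulVec z.1 j) (Bmap Q M S a z.2 j)).trans (add_le_add this b)
        rw [abs_mul, abs_of_pos hδ]
        calc δ * _ ≤ 1 * _ := mul_le_mul_of_nonneg_right hδ1 (abs_nonneg _)
          _ ≤ _ := by rw [one_mul]; refine b'.trans (le_of_eq ?_); ring
    · intro i
      have := hz2 i
      rw [abs_mul, abs_of_pos hδ2]
      have h3 := mul_le_mul_of_nonneg_left this hδ2.le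
      refine h3.trans ?_
      have : δ ^ 2 * (r * (if i ∈ S' then (δ ^ 2)⁻¹ else 1)) ≤ r := by
        by_cases hi : i ∈ S'
        · simp only [hi, if_true]; apply le_of_eq; field_simp
        · simp only [hi, if_false]; nlinarith
      nlinarith

lemma exists_radius {d n : ℕ} (φ : SchwartzMap ((Fin d → ℝ) × (Fin n → ℝ)) ℂ) (h0 : φ 0 = 1) :
    ∃ r : ℝ, 0 < r ∧ ∀ (t : ℝ) (w : (Fin d → ℝ) × (Fin n → ℝ)), |t| ≤ r → (∀ j, |w.1 j| ≤ r) →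
      (∀ i, |w.2 i| ≤ r) →
      1 / 2 ≤ (Complex.exp (((2 * Real.pi * t : ℝ) : ℂ) * Complex.I) * φ w).re := by
  let G : ℝ × ((Fin d → ℝ) × (Fin n → ℝ)) → ℝ := fun tw =>
    (Complex.exp (((2 * Real.pi * tw.1 : ℝ) : ℂ) * Complex.I) * φ tw.2).re
  have hG : Continuous G := by
    have := φ.continuous
    fun_prop
  have hG0 : G 0 = 1 := by simp [G, h0]
  have hev : ∀ᶠ tw in nhds (0 : ℝ × ((Fin d → ℝ) × (Fin n → ℝ))), 1 / 2 < G tw := by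
    refine hG.continuousAt.eventually_const_lt ?_
    rw [hG0]; norm_num
  obtain ⟨ε, hε, hb⟩ := Metric.eventually_nhds_iff.mp hev
  refine ⟨ε / 2, by positivity, fun t w ht hw1 hw2 => ?_⟩
  refine (hb (y := (t, w)) ?_).le
  rw [dist_zero_right]
  have h1 : ‖w.1‖ ≤ ε / 2 := (pi_norm_le_iff_of_nonneg (by positivity)).mpr (by simpa using hw1)
  have h2 : ‖w.2‖ ≤ ε / 2 := (pi_norm_le_iff_of_nonneg (by positivity)).mpr (by simpa using hw2)
  have h3 : ‖(t, w)‖ ≤ ε / 2 := by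
    rw [Prod.norm_def, Prod.norm_def]
    exact max_le (by simpa using ht) (max_le h1 h2)
  linarith

lemma fiber_lower {ι : Type*} (s : Finset ι) (u : ℂ) (hu : ‖u‖ = 1) (f v : ι → ℂ)
    (hf : ∀ i ∈ s, f i = u * v i) (hv : ∀ i ∈ s, 1 / 2 ≤ (v i).re) :
    (s.card : ℝ) / 2 ≤ ‖∑ i ∈ s, f i‖ := by
  rw [Finset.sum_congr rfl hf, ← Finset.mul_sum, norm_mul, hu, one_mul]
  refine le_trans ?_ (Complex.re_le_norm _)
  rw [Complex.re_sum]
  refine le_trans (le_of_eq ?_) (Finset.card_nsmul_le_sum s _ _ hv)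
  simp; ring

lemma combine {α ι G : Type*} [MeasurableSpace α] [Fintype ι] [DecidableEq G] (μ : Measure α)
    (R : Set α) (hRm : MeasurableSet R) (V : ℝ) (hR : μ R = ENNReal.ofReal V) (hV : 0 ≤ V)
    (f : ι → α → ℂ) (hf : ∀ i, Measurable (f i)) (key : ι → G)
    (hpt : ∀ z ∈ R, ∀ g, ((Finset.univ.filter fun i => key i = g).card : ℝ) / 2
      ≤ ‖∑ i ∈ Finset.univ.filter (fun i => key i = g), f i z‖)
    (T : ℝ) (hT : 0 < T) (hcard : ((Finset.univ.image key).card : ℝ) ≤ T) :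
    ∃ s : G → ℂ, (∀ g, ‖s g‖ = 1) ∧
      ENNReal.ofReal (V * (Fintype.card ι / (2 * Real.sqrt T)) ^ 2)
        ≤ ∫⁻ z in R, ‖∑ i, s (key i) * f i z‖ₑ ^ 2 ∂μ := by
  classical
  obtain ⟨s, hs, hle⟩ := exists_signs (μ.restrict R)
    (fun g z => ∑ i ∈ Finset.univ.filter (fun i => key i = g), f i z)
    (fun g => Finset.measurable_sum _ fun i _ => hf i) (Finset.univ.image key)
  refine ⟨s, hs, ?_⟩
  have e1 : ∀ z, ∑ g ∈ Finset.univ.image key,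
      s g * ∑ i ∈ Finset.univ.filter (fun i => key i = g), f i z = ∑ i, s (key i) * f i z := by
    intro z
    rw [← Finset.sum_fiberwise_of_maps_to (g := key) (t := Finset.univ.image key)
      (fun i hi => Finset.mem_image_of_mem key hi)]
    refine Finset.sum_congr rfl fun g _ => ?_
    rw [Finset.mul_sum]
    refine Finset.sum_congr rfl fun i hi => ?_
    rw [(Finset.mem_filter.mp hi).2]
  simp only [e1] at hle
  refine le_trans ?_ hle
  have h2 : ∀ g, ENNReal.ofReal (V * (((Finset.univ.filter fun i => key i = g).card : ℝ) / 2) ^ 2)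
      ≤ ∫⁻ z in R, ‖∑ i ∈ Finset.univ.filter (fun i => key i = g), f i z‖ₑ ^ 2 ∂μ := by
    intro g
    have : ∫⁻ z in R, ENNReal.ofReal ((((Finset.univ.filter fun i => key i = g).card : ℝ) / 2) ^ 2) ∂μ
        ≤ ∫⁻ z in R, ‖∑ i ∈ Finset.univ.filter (fun i => key i = g), f i z‖ₑ ^ 2 ∂μ := by
      refine setLIntegral_mono' hRm fun z hz => ?_
      rw [← ofReal_norm, ← ENNReal.ofReal_pow (norm_nonneg _)]
      exact ENNReal.ofReal_le_ofReal (pow_le_pow_left₀ (by positivity) (hpt z hz g) 2)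
    rw [setLIntegral_const, hR, ← ENNReal.ofReal_mul (by positivity), mul_comm] at this
    exact this
  refine le_trans ?_ (Finset.sum_le_sum fun g _ => h2 g)
  rw [← ENNReal.ofReal_sum_of_nonneg (fun g _ => by positivity)]
  apply ENNReal.ofReal_le_ofReal
  rw [← Finset.mul_sum]
  refine mul_le_mul_of_nonneg_left ?_ hV
  have h3 : (Fintype.card ι : ℝ)
      = ∑ g ∈ Finset.univ.image key, ((Finset.univ.filter fun i => key i = g).card : ℝ) := by
    rw [← Nat.cast_sum, ← Finset.card_eq_sum_card_fiberwise
      (fun i hi => Finset.mem_coe.mpr (Finset.mem_image_of_mem key hi))]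
    rfl
  have h4 := sq_sum_le_card_mul_sum_sq (s := Finset.univ.image key)
    (f := fun g => ((Finset.univ.filter fun i => key i = g).card : ℝ))
  rw [← h3] at h4
  simp only [div_pow, mul_pow, Real.sq_sqrt hT.le, ← Finset.sum_div]
  rw [div_le_div_iff₀ (by positivity) (by positivity)]
  have h5 : 0 ≤ ∑ g ∈ Finset.univ.image key,
    ((Finset.univ.filter fun i => key i = g).card : ℝ) ^ 2 :=
      Finset.sum_nonneg fun g _ => by positivity
  nlinarith [mul_le_mul_of_nonneg_right hcard h5]

lemma card_keys {ι : Type*} [Fintype ι] {d : ℕ} (S : Finset (Fin d)) (key : ι → Fin d → ℤ) (L : ℝ)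
    (hL : 0 ≤ L) (hk : ∀ i j, |(key i j : ℝ)| ≤ L) (hk0 : ∀ i, ∀ j, j ∉ S → key i j = 0) :
    ((Finset.univ.image key).card : ℝ) ≤ (2 * L + 1) ^ S.card := by
  classical
  let P : Fin d → Finset ℤ := fun j => if j ∈ S then Finset.Icc (-⌊L⌋) ⌊L⌋ else {0}
  have hsub : Finset.univ.image key ⊆ Fintype.piFinset P := by
    intro g hg
    obtain ⟨i, -, rfl⟩ := Finset.mem_image.mp hg
    rw [Fintype.mem_piFinset]
    intro j
    by_cases hj : j ∈ S
    · simp only [P, hj, if_true, Finset.mem_Icc]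
      have := abs_le.mp (hk i j)
      constructor
      · rw [neg_le]; exact Int.le_floor.mpr (by push_cast; linarith)
      · exact Int.le_floor.mpr this.2
    · simp [P, hj, hk0 i j hj]
  have h1 := Finset.card_le_card hsub
  rw [Fintype.card_piFinset] at h1
  have h2 : ((Finset.univ.image key).card : ℝ) ≤ ((∏ j, (P j).card : ℕ) : ℝ) := by exact_mod_cast h1
  refine h2.trans ?_
  push_cast
  have h3 : ∀ j, ((P j).card : ℝ) ≤ if j ∈ S then 2 * L + 1 else 1 := by
    intro j
    by_cases hj : j ∈ S
    · simp only [P, hj, if_true, Int.card_Icc]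
      have hf : (0:ℤ) ≤ ⌊L⌋ := Int.floor_nonneg.mpr hL
      have e : ((⌊L⌋ + 1 - -⌊L⌋).toNat : ℤ) = ⌊L⌋ + 1 - -⌊L⌋ := Int.toNat_of_nonneg (by omega)
      have e' : ((⌊L⌋ + 1 - -⌊L⌋).toNat : ℝ) = ⌊L⌋ + 1 - -⌊L⌋ := by exact_mod_cast e
      rw [e']
      linarith [Int.floor_le L]
    · simp [P, hj]
  refine (Finset.prod_le_prod (fun j _ => by positivity) (fun j _ => h3 j)).trans (le_of_eq ?_)
  rw [Finset.prod_ite_mem, Finset.univ_inter, Finset.prod_const]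

lemma numerology (x V0 b0 J Cφ P q e1 e2 e3 e4 D : ℝ) (hx : 0 < x) (hV0 : 0 < V0)
    (hJ : 0 < J) (hC : 0 < Cφ)
    (h : (V0 * x ^ e1) ^ P * (b0 * x ^ e2) ≤ D * ((x ^ e3) ^ q * ((J * x ^ e4) ^ P * Cφ))) :
    V0 ^ P * b0 / (J ^ P * Cφ) * x ^ (e1 * P + e2 - e3 * q - e4 * P) ≤ D := by
  rw [Real.mul_rpow hV0.le (by positivity), Real.mul_rpow hJ.le (by positivity),
    ← Real.rpow_mul hx.le, ← Real.rpow_mul hx.le, ← Real.rpow_mul hx.le] at h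
  rw [Real.rpow_sub hx, Real.rpow_sub hx, Real.rpow_add hx]
  have h1 : 0 < x ^ (e3 * q) := Real.rpow_pos_of_pos hx _
  have h2 : 0 < x ^ (e4 * P) := Real.rpow_pos_of_pos hx _
  have h3 : 0 < J ^ P := Real.rpow_pos_of_pos hJ _
  have e : V0 ^ P * b0 / (J ^ P * Cφ) * (x ^ (e1 * P) * x ^ e2 / x ^ (e3 * q) / x ^ (e4 * P))
    = (V0 ^ P * x ^ (e1 * P) * (b0 * x ^ e2)) / (x ^ (e3 * q) * (J ^ P * x ^ (e4 * P) * Cφ)) := by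
    field_simp
  rw [e, div_le_iff₀ (by positivity)]
  exact h

lemma prod_ite_card {d : ℕ} (S : Finset (Fin d)) (u v : ℝ) :
    ∏ j, (v * if j ∈ S then u else 1) = v ^ d * u ^ S.card := by
  rw [Finset.prod_mul_distrib, Finset.prod_ite_mem, Finset.univ_inter, Finset.prod_const,
    Finset.prod_const, Finset.card_univ, Fintype.card_fin]

lemma center_bound {d : ℕ} (k : ℕ) (ν : Fin d → Fin (2 ^ k)) (j : Fin d) :
    |center k ν j| ≤ 1 := by
  have h1 : ((ν j : ℕ) : ℝ) + 1 ≤ 2 ^ k := by exact_mod_cast (ν j).isLt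
  have h0 : (0:ℝ) < 2 ^ k := by positivity
  rw [center, abs_of_nonneg (by positivity), pow_succ]
  have : ((ν j : ℕ) : ℝ) / 2 ^ k + 1 / (2 ^ k * 2) = (2 * (ν j : ℕ) + 1) / (2 ^ k * 2) := by
    field_simp
  rw [this, div_le_one (by positivity)]
  linarith

lemma main_example {d n : ℕ} (Q : Fin n → QF d) (Cb : ℝ) (hCb : 1 ≤ Cb)
    (n' : ℕ) (hn' : n' ≤ n) :
    ∃ V0 b0 J : ℝ, 0 < V0 ∧ 0 < b0 ∧ 0 < J ∧
    ∃ φ : SchwartzMap ((Fin d → ℝ) × (Fin n → ℝ)) ℂ, ∀ k : ℕ, ∀ p : ℝ≥0∞, 2 ≤ p →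
    ∃ f : (Fin d → Fin (2 ^ k)) → SchwartzMap ((Fin d → ℝ) × (Fin n → ℝ)) ℂ,
      (∀ ν, Function.support (fourierT (⇑(f ν))) ⊆ Ubox Q (1 / 2 ^ k) Cb (center k ν)) ∧
      (∀ ν, eLpNorm (⇑(f ν)) p volume
        = ENNReal.ofReal (J * ((2:ℝ) ^ k) ^ ((d : ℝ) + numvar Q d n' + 2 * n)) ^ (1 / p.toReal)
          * eLpNorm φ p volume) ∧
      ENNReal.ofReal ((V0 * ((2:ℝ) ^ k) ^ (2 * ((numvar Q d n' : ℝ) + n'))) ^ (1 / p.toReal)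
        * (b0 * ((2:ℝ) ^ k) ^ ((d : ℝ) - numvar Q d n' / 2)))
        ≤ eLpNorm (fun z => ∑ ν, f ν z) p volume := by
  classical
  obtain ⟨M, N, S, S', hM, hSc, hSc', hS⟩ := numvar_normal Q n' hn'
  obtain ⟨K, hK, hK1, hK2, hK3, hK4, hK5, hK6⟩ := exists_bounds Q M N
  obtain ⟨J, hJ, hmap⟩ := exists_map M hM N
  have hK0 : 0 < K := by linarith
  obtain ⟨h, hh, hh1, hb1, hb2⟩ : ∃ h : ℝ, 0 < h ∧ h ≤ 1 ∧ K * (h + h) ≤ 1 ∧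
      K * (K * h) ^ 2 + K * (K * h) + K * h ≤ 1 := by
    have a1 : 1 ≤ K ^ 2 := by nlinarith
    have a2 : 1 ≤ K ^ 3 := by nlinarith
    refine ⟨1 / (4 * K ^ 3), by positivity, ?_, ?_, ?_⟩
    · rw [div_le_one (by positivity)]; linarith
    · have : K * (1 / (4 * K ^ 3) + 1 / (4 * K ^ 3)) = 1 / (2 * K ^ 2) := by field_simp; norm_num
      rw [this, div_le_one (by positivity)]; linarith
    · have : K * (K * (1 / (4 * K ^ 3))) ^ 2 + K * (K * (1 / (4 * K ^ 3))) + K * (1 / (4 * K ^ 3))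
          = (1 / (16 * K ^ 3)) + 1 / (4 * K) + 1 / (4 * K ^ 2) := by field_simp; ring
      rw [this]
      have c1 : 1 / (16 * K ^ 3) ≤ 1 / 4 :=
        one_div_le_one_div_of_le (by norm_num) (by linarith)
      have c2 : 1 / (4 * K) ≤ 1 / 4 := one_div_le_one_div_of_le (by norm_num) (by linarith)
      have c3 : 1 / (4 * K ^ 2) ≤ 1 / 4 := one_div_le_one_div_of_le (by norm_num) (by linarith)
      linarith
  obtain ⟨φ, hφ0, hφs⟩ := exists_phi d n h hh
  obtain ⟨r0, hr0, hrad⟩ := exists_radius φ hφ0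
  obtain ⟨r, hr, hr1, hr2⟩ : ∃ r : ℝ, 0 < r ∧ r * (2 * d * K + 4 * n * K ^ 6) ≤ r0 ∧
      r * (1 + n * K ^ 3) ≤ r0 := by
    have p1 : 0 ≤ 2 * (d:ℝ) * K + 4 * n * K ^ 6 := by positivity
    have p2 : 0 < 1 + (n:ℝ) * K ^ 3 := by positivity
    refine ⟨r0 / ((2 * (d:ℝ) * K + 4 * n * K ^ 6) + (1 + (n:ℝ) * K ^ 3)), by positivity, ?_, ?_⟩
    · rw [div_mul_eq_mul_div, div_le_iff₀ (by positivity)]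
      exact mul_le_mul_of_nonneg_left (by linarith) hr0.le
    · rw [div_mul_eq_mul_div, div_le_iff₀ (by positivity)]
      exact mul_le_mul_of_nonneg_left (by linarith) hr0.le
  set m := numvar Q d n' with hm
  set K' : ℝ := 2 * (K / h + 1) + 1 with hK'
  have hK'0 : 0 < K' := by positivity
  refine ⟨J * ((2 * r) ^ d * (2 * r) ^ n), 1 / (2 * Real.sqrt (K' ^ m)), J, by positivity,
    by positivity, hJ, φ, fun k p hp => ?_⟩
  set x : ℝ := 2 ^ k with hx
  have hx1 : 1 ≤ x := one_le_pow₀ (by norm_num)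
  have hx0 : 0 < x := by linarith
  set δ : ℝ := 1 / x with hδ
  have hδ0 : 0 < δ := by positivity
  have hδ1 : δ ≤ 1 := by rw [hδ, div_le_one hx0]; exact hx1
  have hxδ : x = δ⁻¹ := by rw [hδ]; simp
  let ξ : (Fin d → Fin (2 ^ k)) → Fin d → ℝ := fun ν => Matrix.vecMul (center k ν) M⁻¹
  have hξa : ∀ ν, center k ν = Matrix.vecMul (ξ ν) M := by
    intro ν
    simp only [ξ, Matrix.vecMul_vecMul, Matrix.nonsing_inv_mul M hM, Matrix.vecMul_one]
  have hξb : ∀ ν j, |ξ ν j| ≤ K := by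
    intro ν j
    have := hK2 (center k ν) 1 zero_le_one (center_bound k ν) j
    rwa [mul_one] at this
  let key : (Fin d → Fin (2 ^ k)) → Fin d → ℤ := fun ν j =>
    if j ∈ S then ⌊ξ ν j / (h * δ)⌋ else 0
  let ξt : (Fin d → Fin (2 ^ k)) → Fin d → ℝ := fun ν j =>
    if j ∈ S then h * δ * key ν j else ξ ν j
  have hhδ : 0 < h * δ := by positivity
  have hξt : ∀ ν j, |ξt ν j - ξ ν j| ≤ h * δ := by
    intro ν j
    by_cases hj : j ∈ S
    · simp only [ξt, key, hj, if_true]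
      have f1 := Int.floor_le (ξ ν j / (h * δ))
      have f2 := Int.lt_floor_add_one (ξ ν j / (h * δ))
      rw [le_div_iff₀ hhδ] at f1
      rw [div_lt_iff₀ hhδ] at f2
      rw [abs_le]
      constructor <;> nlinarith
    · simp only [ξt, hj, if_false, sub_self, abs_zero]; exact hhδ.le
  have hhδK : h * δ ≤ K := by nlinarith
  have hξtb : ∀ ν j, |ξt ν j| ≤ 2 * K := by
    intro ν j
    have := abs_add_le (ξt ν j - ξ ν j) (ξ ν j)
    rw [sub_add_cancel] at this
    linarith [hξt ν j, hξb ν j]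
  have hcard : ((Finset.univ.image key).card : ℝ) ≤ (K' * x) ^ m := by
    have hL : ∀ ν j, |(key ν j : ℝ)| ≤ K / (h * δ) + 1 := by
      intro ν j
      have hKh : 0 ≤ K / (h * δ) := by positivity
      by_cases hj : j ∈ S
      · simp only [key, hj, if_true]
        have f1 := Int.floor_le (ξ ν j / (h * δ))
        have f2 := Int.lt_floor_add_one (ξ ν j / (h * δ))
        have f3 : |ξ ν j / (h * δ)| ≤ K / (h * δ) := by
          rw [abs_div, abs_of_pos hhδ]
          exact div_le_div_of_nonneg_right (hξb ν j) hhδ.le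
        have f4 := abs_le.mp f3
        rw [abs_le]
        constructor <;> linarith
      · simp only [key, hj, if_false, Int.cast_zero, abs_zero]; linarith
    have := card_keys S key (K / (h * δ) + 1) (by positivity) hL
      (fun ν j hj => by simp [key, hj])
    rw [hSc] at this
    refine this.trans (pow_le_pow_left₀ (by positivity) ?_ m)
    have e : K / (h * δ) = K / h * x := by rw [hδ]; field_simp
    rw [e, hK']
    nlinarith
  let w : Fin d → ℝ := fun j => if j ∈ S then δ ^ 2 else δ
  have hw : ∀ j, 0 < w j := by
    intro j; by_cases hj : j ∈ S <;> simp [w, hj, hδ0]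
  choose A hA hAm using fun ν => hmap w hw (δ ^ 2) (by positivity) (Bmap Q M S (center k ν))
  have hcA : J / ((∏ j, w j) * (δ ^ 2) ^ n) = J * x ^ ((d : ℝ) + m + 2 * n) := by
    have e1 : ∏ j, w j = δ ^ d * δ ^ m := by
      rw [← hSc, ← prod_ite_card]
      refine Finset.prod_congr rfl fun j _ => ?_
      by_cases hj : j ∈ S <;> simp [w, hj, sq]
    have e2 : x ^ ((d : ℝ) + m + 2 * n) = x ^ (d + m + 2 * n) := by
      rw [← Real.rpow_natCast]; push_cast; rfl
    rw [e1, e2, hxδ, ← pow_mul, ← pow_add, ← pow_add, inv_pow, div_eq_mul_inv]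
  have hcA0 : 0 < J * x ^ ((d : ℝ) + m + 2 * n) := by positivity
  rw [hcA] at hAm
  let θ : (Fin d → Fin (2 ^ k)) → (Fin d → ℝ) × (Fin n → ℝ) := fun ν =>
    (Matrix.vecMul (ξt ν) M, fun i => Q i (Matrix.vecMul (ξt ν) M))
  let f0 : (Fin d → Fin (2 ^ k)) → ((Fin d → ℝ) × (Fin n → ℝ)) → ℂ := fun ν z =>
    Complex.exp (((2 * Real.pi * dot z (θ ν) : ℝ) : ℂ) * Complex.I) * φ (A ν z)
  obtain ⟨A1, hA1, hA1m⟩ := hmap (fun _ => 1) (fun _ => one_pos) 1 one_pos 0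
  simp only [Finset.prod_const_one, one_pow, mul_one, div_one] at hA1m
  let ra : Fin d → ℝ := fun j => r * (if j ∈ S then (δ ^ 2)⁻¹ else 1)
  let rb : Fin n → ℝ := fun i => r * (if i ∈ S' then (δ ^ 2)⁻¹ else 1)
  have hra : ∀ j, 0 < ra j := by
    intro j; by_cases hj : j ∈ S <;> simp only [ra, hj, if_true, if_false] <;> positivity
  have hrb : ∀ i, 0 < rb i := by
    intro j; by_cases hj : j ∈ S' <;> simp only [rb, hj, if_true, if_false] <;> positivity
  obtain ⟨hRm, hRv⟩ := volume_region A1 J hA1m hJ ra rb hra hrb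
  set R := {z | (∀ j, |(A1 z).1 j| ≤ ra j) ∧ ∀ i, |(A1 z).2 i| ≤ rb i} with hRdef
  have hV : J * ((∏ j, (2 * ra j)) * ∏ i, (2 * rb i))
      = J * ((2 * r) ^ d * (2 * r) ^ n) * x ^ (2 * ((m : ℝ) + n')) := by
    have e1 : ∏ j, (2 * ra j) = (2 * r) ^ d * ((δ ^ 2)⁻¹) ^ m := by
      rw [← hSc, ← prod_ite_card]
      exact Finset.prod_congr rfl fun j _ => by simp only [ra]; ring
    have e2 : ∏ i, (2 * rb i) = (2 * r) ^ n * ((δ ^ 2)⁻¹) ^ n' := by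
      rw [← hSc', ← prod_ite_card]
      exact Finset.prod_congr rfl fun j _ => by simp only [rb]; ring
    have e3 : x ^ (2 * ((m : ℝ) + n')) = x ^ (2 * (m + n')) := by
      rw [← Real.rpow_natCast]; push_cast; rfl
    rw [e1, e2, e3, hxδ, pow_mul, pow_add, ← inv_pow]
    ring
  rw [hV] at hRv
  have hpt : ∀ z ∈ R, ∀ g, ((Finset.univ.filter fun ν => key ν = g).card : ℝ) / 2
      ≤ ‖∑ ν ∈ Finset.univ.filter (fun ν => key ν = g), f0 ν z‖ := by
    intro z hz g
    have hz' := hz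
    simp only [hRdef, Set.mem_ofPred_eq, hA1, one_mul, LinearMap.zero_apply, Pi.zero_apply,
      add_zero] at hz'
    obtain ⟨g1, g2⟩ := region_lemma Q M N S S' hS K hK hK1 hK3 hK5 hK6 δ r hδ0 hδ1 hr.le z
      hz'.1 hz'.2
    set η : Fin d → ℝ := fun j => if j ∈ S then h * δ * g j else 0 with hη
    set Φ : ℝ := dot z (Matrix.vecMul η M, 0)
          + ∑ i, N (fun i => if i ∈ S' then N.symm z.2 i else 0) i *
            Q i (Matrix.vecMul η M) with hΦ
    refine fiber_lower _ (Complex.exp (((2 * Real.pi * Φ : ℝ) : ℂ) * Complex.I))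
      (Complex.norm_exp_ofReal_mul_I _) _
      (fun ν => Complex.exp (((2 * Real.pi * (dot z (θ ν) - Φ) : ℝ) : ℂ) * Complex.I) * φ (A ν z))
      ?_ ?_
    · intro ν _
      simp only [f0]
      rw [← mul_assoc, ← Complex.exp_add]
      congr 2
      push_cast
      ring
    · intro ν hν
      have hkey : key ν = g := (Finset.mem_filter.mp hν).2
      have hηξ : (fun j => if j ∈ S then ξt ν j else 0) = η := by
        ext j
        by_cases hj : j ∈ S
        · simp only [hη, hj, if_true, ξt, hkey]
        · simp only [hη, hj, if_false]
      have q1 := g1 (ξt ν) (hξtb ν)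
      rw [hηξ] at q1
      obtain ⟨q2, q3⟩ := g2 (center k ν) (ξ ν) (hξa ν) (center_bound k ν)
      refine hrad _ _ (q1.trans hr1) ?_ ?_
      · intro j
        rw [hA]
        exact (q2 j).trans hr2
      · intro i
        rw [hA]
        exact (q3 i).trans hr2
  have hf0m : ∀ ν, Measurable (f0 ν) := by
    intro ν
    refine Continuous.measurable ?_
    have c1 := φ.continuous
    have c2 := (A ν).continuous
    simp only [f0, dot]
    fun_prop
  obtain ⟨s, hs1, hs2⟩ := combine volume R hRm _ hRv (by positivity) f0 hf0m key hpt
    ((K' * x) ^ m) (by positivity) hcard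
  choose f hf hfs using fun ν => exists_packet φ (A ν) (θ ν) (s (key ν))
  refine ⟨f, ?_, ?_, ?_⟩
  · intro ν ζ hζ
    obtain ⟨κ, hκ, hκd⟩ := hfs ν ζ hζ
    obtain ⟨k1, k2⟩ := hφs κ hκ
    exact support_lemma Q M N S K hK hK1 hK4 hK5 hK6 δ h h Cb hδ0 hδ1 hh.le hh.le hCb hb1 hb2
      (center k ν) (ξ ν) (ξt ν) (hξa ν) (center_bound k ν) (hξt ν) ζ κ k1 k2 (A ν) (hA ν) hκd
  · intro ν
    refine eLpNorm_packet φ (A ν) (f ν) (fun z => ?_) _ hcA0 (hAm ν) p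
    rw [hf, norm_mul, norm_mul, hs1, Complex.norm_exp_ofReal_mul_I, one_mul, one_mul]
  · have hfe : (fun z => ∑ ν, f ν z) = fun z => ∑ ν, s (key ν) * f0 ν z := by
      ext z
      exact Finset.sum_congr rfl fun ν _ => hf ν z
    have hb : (Fintype.card (Fin d → Fin (2 ^ k)) : ℝ) / (2 * Real.sqrt ((K' * x) ^ m))
        = 1 / (2 * Real.sqrt (K' ^ m)) * x ^ ((d : ℝ) - m / 2) := by
      rw [mul_pow, Real.sqrt_mul (by positivity), Real.rpow_sub hx0, Real.rpow_natCast]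
      have e1 : Real.sqrt (x ^ m) = x ^ ((m : ℝ) / 2) := by
        rw [Real.sqrt_eq_rpow, ← Real.rpow_natCast, ← Real.rpow_mul hx0.le]
        congr 1; ring
      have e2 : (Fintype.card (Fin d → Fin (2 ^ k)) : ℝ) = x ^ d := by
        simp [hx]
      rw [e1, e2]
      field_simp
    rw [hb] at hs2
    rw [hfe]
    refine eLpNorm_lower volume R _ _ (by positivity) hRv (by positivity) _ ?_ hs2 p hp
    exact (Finset.measurable_sum _ fun ν _ => (hf0m ν).const_mul _).aestronglyMeasurable

/-- Proposition 6.2, lower bound: for every `0 ≤ n' ≤ n` and all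
exponents `2 ≤ q, p ≤ ∞` (with `1/∞ = 0`),
`Γ_{q,p}(𝐪) ≥ d(1 - 1/p - 1/q) - 𝔡_{n'}(𝐪)(1/2 - 1/p) - 2(n - n')/p`. -/
theorem statement_18 (d n : ℕ) (hd : 1 ≤ d) (hn : 1 ≤ n)
    (Q : Fin n → QF d) (Cb : ℝ) (hCb : 1 ≤ Cb)
    (n' : ℕ) (hn' : n' ≤ n)
    (q p : ℝ≥0∞) (hq : 2 ≤ q) (hp : 2 ≤ p) :
    (d : ℝ) * (1 - 1 / p.toReal - 1 / q.toReal)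
        - (numvar Q d n' : ℝ) * (1 / 2 - 1 / p.toReal)
        - 2 * ((n : ℝ) - (n' : ℝ)) / p.toReal
      ≤ Gamma Q Cb q p := by
  obtain ⟨V0, b0, J, hV0, hb0, hJ, φ, hex⟩ := main_example Q Cb hCb n' hn'
  set m := numvar Q d n' with hm
  have hφ : eLpNorm φ p volume ≠ ∞ := (φ.memLp p volume).2.ne
  set Cφ : ℝ := (eLpNorm φ p volume).toReal + 1 with hCφ
  have hCφ0 : 0 < Cφ := by positivity
  have hφle : eLpNorm φ p volume ≤ ENNReal.ofReal Cφ := by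
    rw [← ENNReal.ofReal_toReal hφ]
    exact ENNReal.ofReal_le_ofReal (by rw [hCφ]; linarith)
  have hE : (d : ℝ) * (1 - 1 / p.toReal - 1 / q.toReal) - (m : ℝ) * (1 / 2 - 1 / p.toReal)
        - 2 * ((n : ℝ) - (n' : ℝ)) / p.toReal
      = (2 * ((m : ℝ) + n')) * (1 / p.toReal) + ((d : ℝ) - m / 2) - d * (1 / q.toReal)
        - ((d : ℝ) + m + 2 * n) * (1 / p.toReal) := by
    ring
  rw [hE]
  refine gamma_lower Q Cb q p hq hp _ (V0 ^ (1 / p.toReal) * b0 / (J ^ (1 / p.toReal) * Cφ))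
    (by positivity) fun k hk D hD hdec => ?_
  obtain ⟨f, hfs, hfn, hfl⟩ := hex k p hp
  have h1 := hfl.trans (hdec f hfs)
  set x : ℝ := (2 : ℝ) ^ k with hx
  have hx0 : 0 < x := by positivity
  have : Nonempty (Fin d → Fin (2 ^ k)) := ⟨fun _ => ⟨0, by positivity⟩⟩
  have h2 := lqNorm_le q hq (fun ν => eLpNorm (⇑(f ν)) p volume)
    (ENNReal.ofReal ((J * x ^ ((d : ℝ) + m + 2 * n)) ^ (1 / p.toReal) * Cφ)) (fun ν => by
      rw [hfn, ENNReal.ofReal_rpow_of_nonneg (by positivity) (by positivity),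
        ENNReal.ofReal_mul (by positivity)]
      gcongr)
  have hcard : (Fintype.card (Fin d → Fin (2 ^ k)) : ℝ≥0∞) = ENNReal.ofReal (x ^ (d : ℝ)) := by
    rw [Real.rpow_natCast, hx, ENNReal.ofReal_pow (by positivity),
      ENNReal.ofReal_pow (by positivity)]
    simp
  rw [hcard, ENNReal.ofReal_rpow_of_nonneg (by positivity) (by positivity),
    ← ENNReal.ofReal_mul (by positivity)] at h2
  have h3 := h1.trans (mul_le_mul_right h2 _)
  rw [← ENNReal.ofReal_mul hD, ENNReal.ofReal_le_ofReal_iff (by positivity)] at h3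
  exact numerology x V0 b0 J Cφ _ _ _ _ _ _ D hx0 hV0 hJ hCφ0 h3

end GOZZK
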